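/- Let p₁,…,p_l be holomorphic polynomials on ℂ² and let 𝔇_l := { z ∈ ℂ² : |p₁(z)| < 1, …, |p_l(z)| < 1 } be a complex non-degenerate polynomial polyhedron. Then every totally real C²-smooth disc contained in the non-singular part of the boundary ∂𝔇_l (i.e., lying in some single face Σ_j = { z : |p_j(z)| = 1 } and avoiding all intersections Σ_{j₁} ∩ Σ_{j₂} with j₁ ≠ j₂) is polynomially convex. -/

import Mathlib

noncomputable section

/-- The polynomial (convex) hull of a set `K ⊆ ℂⁿ`:
`K̂ = { z : |p(z)| ≤ sup_K |p| for every holomorphic polynomial p }`. -/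
def polyHull (n : ℕ) (K : Set (Fin n → ℂ)) : Set (Fin n → ℂ) :=
  {z | ∀ p : MvPolynomial (Fin n) ℂ,
    ‖MvPolynomial.eval z p‖ ≤ sSup ((fun w => ‖MvPolynomial.eval w p‖) '' K)}

/-- A set `K ⊆ ℂⁿ` is polynomially convex if it equals its polynomial hull. -/
def PolyConvex (n : ℕ) (K : Set (Fin n → ℂ)) : Prop := polyHull n K = K

/-- A Runge domain in `ℂⁿ`: a domain on which every holomorphic function can be
approximated uniformly on compact subsets by holomorphic polynomials. -/
def RungeDomain (n : ℕ) (Ω : Set (Fin n → ℂ)) : Prop :=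
  IsOpen Ω ∧ IsConnected Ω ∧
  ∀ f : (Fin n → ℂ) → ℂ, DifferentiableOn ℂ f Ω →
    ∀ K : Set (Fin n → ℂ), K ⊆ Ω → IsCompact K → ∀ ε : ℝ, 0 < ε →
      ∃ p : MvPolynomial (Fin n) ℂ, ∀ z ∈ K, ‖f z - MvPolynomial.eval z p‖ ≤ ε

/-- `K ⊆ ℂⁿ` is a totally real `C²`-smooth disc: the image of the closed unit
disc in `ℝ²` under a `C²` embedding `φ` (defined on an open neighborhood `U` of
the closed disc) whose image is a totally real submanifold, i.e. at each point
the tangent plane `W = range (dφ)` satisfies `W ∩ i·W = {0}`. -/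
def TotallyRealDisc (n : ℕ) (K : Set (Fin n → ℂ)) : Prop :=
  ∃ (U : Set (ℝ × ℝ)) (φ : ℝ × ℝ → (Fin n → ℂ)),
    IsOpen U ∧ Metric.closedBall (0 : ℝ × ℝ) 1 ⊆ U ∧
    ContDiffOn ℝ 2 φ U ∧ Set.InjOn φ U ∧
    (∀ x ∈ U, Function.Injective (fderiv ℝ φ x)) ∧
    (∀ x ∈ U, ∀ v w : ℝ × ℝ,
      fderiv ℝ φ x v = Complex.I • fderiv ℝ φ x w → fderiv ℝ φ x v = 0) ∧
    K = φ '' Metric.closedBall (0 : ℝ × ℝ) 1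

section

open Metric Set Filter Topology

theorem exists_norm_pow_lt_of_spectralRadius_lt {A : Type*} [NormedRing A] [NormedAlgebra ℂ A]
    [CompleteSpace A] {a : A} {ρ : ℝ} (hρ : 0 < ρ)
    (h : spectralRadius ℂ a < ENNReal.ofReal ρ) : ∃ N : ℕ, 1 ≤ N ∧ ‖a ^ N‖ < ρ ^ N := by
  have h1 := (spectrum.pow_norm_pow_one_div_tendsto_nhds_spectralRadius a).eventually
    (gt_mem_nhds h)
  obtain ⟨N, h2, h3⟩ := (h1.and (eventually_ge_atTop 1)).exists
  refine ⟨N, h3, ?_⟩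
  have h4 := (ENNReal.ofReal_lt_ofReal_iff hρ).1 h2
  have h5 : (‖a ^ N‖ ^ (1 / (N:ℝ))) ^ N < ρ ^ N :=
    pow_lt_pow_left₀ h4 (by positivity) (by omega)
  rwa [← Real.rpow_natCast, ← Real.rpow_mul (norm_nonneg _), one_div_mul_cancel (by positivity),
    Real.rpow_one] at h5

theorem exists_norm_pow_lt_of_characters {A : Type*} [NormedCommRing A] [NormedAlgebra ℂ A]
    [CompleteSpace A] {a : A} {ρ : ℝ} (hρ : 0 < ρ)
    (h : ∀ f : WeakDual.characterSpace ℂ A, ‖f a‖ < ρ) : ∃ N : ℕ, 1 ≤ N ∧ ‖a ^ N‖ < ρ ^ N := by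
  apply exists_norm_pow_lt_of_spectralRadius_lt hρ
  rcases subsingleton_or_nontrivial A with hA | hA
  · rw [spectrum.SpectralRadius.of_subsingleton]; simpa using hρ
  · have := spectrum.spectralRadius_lt_of_forall_lt (r := ρ.toNNReal) a (by
      intro z hz
      obtain ⟨f, rfl⟩ := WeakDual.CharacterSpace.mem_spectrum_iff_exists.1 hz
      rw [← NNReal.coe_lt_coe]
      simpa [hρ.le] using h f)
    simpa [ENNReal.ofReal] using this

/-- Restriction of polynomials to a subset of `ℂⁿ`, as continuous functions. -/
def polyRes {n : ℕ} (K : Set (Fin n → ℂ)) : MvPolynomial (Fin n) ℂ →ₐ[ℂ] C(K, ℂ) :=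
  MvPolynomial.aeval fun i => ⟨fun z => z.1 i, (continuous_apply i).comp continuous_subtype_val⟩

@[simp] theorem polyRes_apply {n : ℕ} (K : Set (Fin n → ℂ)) (p : MvPolynomial (Fin n) ℂ) (z : K) :
    polyRes K p z = MvPolynomial.eval z.1 p := by
  induction p using MvPolynomial.induction_on with
  | C a => simp [polyRes]
  | add p q hp hq => simp [hp, hq]
  | mul_X p i hp =>
    rw [map_mul, map_mul, ContinuousMap.mul_apply, hp]
    simp [polyRes]

theorem continuous_evalPoly {n : ℕ} (p : MvPolynomial (Fin n) ℂ) :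
    Continuous fun z : Fin n → ℂ => MvPolynomial.eval z p :=
  MvPolynomial.continuous_eval p

theorem mem_polyHull_iff {n : ℕ} {K : Set (Fin n → ℂ)} [CompactSpace K] [Nonempty K]
    {z : Fin n → ℂ} :
    z ∈ polyHull n K ↔ ∀ p : MvPolynomial (Fin n) ℂ, ‖MvPolynomial.eval z p‖ ≤ ‖polyRes K p‖ := by
  have key : ∀ p : MvPolynomial (Fin n) ℂ,
      sSup ((fun w => ‖MvPolynomial.eval w p‖) '' K) = ‖polyRes K p‖ := by
    intro p
    rw [ContinuousMap.norm_eq_iSup_norm, iSup, image_eq_range]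
    simp
  simp [polyHull, key]

theorem exists_norm_pow_add_mul_lt {A : Type*} [NormedCommRing A] [NormedAlgebra ℂ A]
    [CompleteSpace A] (g t : A) {ρ : ℝ} (hρ : 0 < ρ)
    (h : ∀ F : A →ₐ[ℂ] ℂ, F t = 0 → ‖F g‖ < ρ) :
    ∃ N : ℕ, 1 ≤ N ∧ ∃ a : A, ‖g ^ N + t * a‖ < ρ ^ N := by
  let I : Ideal A := (Ideal.span {t}).closure
  have hI : IsClosed (I : Set A) := by
    rw [Ideal.coe_closure]; exact isClosed_closure
  have hmem : ∀ x : A, x ∈ I ↔ x ∈ closure (Ideal.span {t} : Set A) := fun x => by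
    rw [← Ideal.coe_closure]; rfl
  have : CompleteSpace (A ⧸ I) := Submodule.Quotient.completeSpace I
  obtain ⟨N, hN, hlt⟩ := exists_norm_pow_lt_of_characters (a := Ideal.Quotient.mk I g) hρ (by
    intro f
    refine h ((WeakDual.CharacterSpace.toAlgHom f).comp (Ideal.Quotient.mkₐ ℂ I)) ?_
    have : Ideal.Quotient.mk I t = 0 := by
      rw [Ideal.Quotient.eq_zero_iff_mem, hmem]
      exact subset_closure (Ideal.subset_span rfl)
    show f (Ideal.Quotient.mk I t) = 0
    rw [this]; exact map_zero f)
  refine ⟨N, hN, ?_⟩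
  rw [← map_pow] at hlt
  obtain ⟨r, hr, hr2⟩ := Ideal.Quotient.norm_mk_lt (Ideal.Quotient.mk I (g ^ N)) (sub_pos.2 hlt)
  have hrlt : ‖r‖ < ρ ^ N := by linarith
  rw [Ideal.Quotient.eq, hmem] at hr
  obtain ⟨c, hc, hc2⟩ := Metric.mem_closure_iff.1 hr _ (sub_pos.2 hrlt)
  obtain ⟨a, rfl⟩ := Ideal.mem_span_singleton.1 hc
  refine ⟨a, ?_⟩
  rw [dist_eq_norm] at hc2
  calc _ = ‖r - (r - g ^ N - t * a)‖ := by congr 1; abel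
    _ ≤ _ := norm_sub_le _ _
    _ < _ := by linarith

theorem exists_eval_pow_add_mul_lt {n : ℕ} {K : Set (Fin n → ℂ)} (hK : IsCompact K)
    (hne : K.Nonempty) (P g : MvPolynomial (Fin n) ℂ) (ζ : ℂ) {ρ : ℝ} (hρ : 0 < ρ)
    (h : ∀ y ∈ polyHull n K, MvPolynomial.eval y P = ζ → ‖MvPolynomial.eval y g‖ < ρ) :
    ∃ N : ℕ, 1 ≤ N ∧ ∃ q : MvPolynomial (Fin n) ℂ, ∀ z ∈ K,
      ‖MvPolynomial.eval z g ^ N + (MvPolynomial.eval z P - ζ) * MvPolynomial.eval z q‖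
        < ρ ^ N := by
  have : CompactSpace K := isCompact_iff_compactSpace.1 hK
  have : Nonempty K := hne.to_subtype
  let A : Subalgebra ℂ C(K, ℂ) := (polyRes K).range.topologicalClosure
  have hAcl : IsClosed (A : Set C(K, ℂ)) := Subalgebra.isClosed_topologicalClosure _
  have : CompleteSpace A := hAcl.completeSpace_coe
  let ι : MvPolynomial (Fin n) ℂ →ₐ[ℂ] A :=
    (polyRes K).codRestrict A (fun p => subset_closure ⟨p, rfl⟩)
  have hbound : ∀ (F : A →ₐ[ℂ] ℂ) (a : A), ‖F a‖ ≤ ‖a‖ := by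
    have : NormOneClass A := ⟨norm_one (α := C(K, ℂ))⟩
    intro F a
    exact AlgHom.norm_apply_le_self F a
  have hdense : DenseRange ι := by
    intro a
    rw [Metric.mem_closure_iff]
    intro ε hε
    have := a.2
    obtain ⟨b, ⟨p, rfl⟩, hb⟩ := Metric.mem_closure_iff.1 this ε hε
    exact ⟨ι p, ⟨p, rfl⟩, hb⟩
  obtain ⟨N, hN, a, hlt2⟩ := exists_norm_pow_add_mul_lt (ι g) (ι (P - MvPolynomial.C ζ)) hρ (by
    intro F hF
    let y : Fin n → ℂ := fun i => F (ι (MvPolynomial.X i))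
    have hy : ∀ q, MvPolynomial.eval y q = F (ι q) := by
      intro q
      have : MvPolynomial.aeval y = F.comp ι := by
        ext i; simp [y]
      have h2 := DFunLike.congr_fun this q
      simpa [MvPolynomial.aeval_eq_eval] using h2
    have hyK : y ∈ polyHull n K := by
      rw [mem_polyHull_iff]
      intro q
      have h1 : ‖F (ι q)‖ ≤ ‖ι q‖ := hbound F _
      rw [hy]
      exact h1
    have hyP : MvPolynomial.eval y P = ζ := by
      rw [← hy] at hF
      simpa [sub_eq_zero] using hF
    have := h y hyK hyP
    rwa [hy] at this)
  have hopen : IsOpen {a : A | ‖ι g ^ N + ι (P - MvPolynomial.C ζ) * a‖ < ρ ^ N} :=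
    isOpen_lt (by fun_prop) continuous_const
  obtain ⟨q, hq⟩ := hdense.exists_mem_open hopen ⟨a, hlt2⟩
  refine ⟨N, hN, q, fun z hz => ?_⟩
  refine lt_of_le_of_lt ?_ hq
  have hev := ContinuousMap.norm_coe_le_norm (polyRes K (g ^ N + (P - MvPolynomial.C ζ) * q)) ⟨z, hz⟩
  rw [polyRes_apply] at hev
  have hιn : ∀ q, ‖ι q‖ = ‖polyRes K q‖ := fun _ => rfl
  rw [← map_pow ι, ← map_mul ι, ← map_add ι, hιn]
  refine le_trans (le_of_eq ?_) hev
  simp only [map_add, map_mul, map_pow, map_sub, MvPolynomial.eval_C]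

theorem exists_functional_of_mem_polyHull {n : ℕ} {K : Set (Fin n → ℂ)} [CompactSpace K]
    [Nonempty K] {x : Fin n → ℂ} (hx : x ∈ polyHull n K) :
    ∃ Λ : C(K, ℂ) →L[ℂ] ℂ, ∀ q, Λ (polyRes K q) = MvPolynomial.eval x q := by
  rw [mem_polyHull_iff] at hx
  have hker : ∀ q q', polyRes K q = polyRes K q' → MvPolynomial.eval x q = MvPolynomial.eval x q' := by
    intro q q' h
    have := hx (q - q')
    rw [map_sub (polyRes K), h, sub_self, norm_zero, map_sub] at this
    exact sub_eq_zero.1 (norm_le_zero_iff.1 this)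
  let W : Subspace ℂ C(K, ℂ) := LinearMap.range (polyRes K).toLinearMap
  have hch : ∀ w : W, ∃ q, polyRes K q = w.1 := fun w => w.2
  choose s hs using hch
  let L : W →ₗ[ℂ] ℂ :=
    { toFun := fun w => MvPolynomial.eval x (s w)
      map_add' := fun a b => by
        rw [← map_add]; apply hker; rw [hs, map_add, hs, hs]; rfl
      map_smul' := fun c a => by
        rw [RingHom.id_apply, smul_eq_mul, ← MvPolynomial.smul_eval]
        apply hker; rw [hs, map_smul, hs]; rfl }
  let L' : W →L[ℂ] ℂ := L.mkContinuous 1 (fun w => by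
    rw [one_mul]
    calc _ ≤ _ := hx (s w)
      _ = _ := by rw [hs]; rfl)
  obtain ⟨Λ, h1, -⟩ := exists_extension_norm_eq W L'
  refine ⟨Λ, fun q => ?_⟩
  have := h1 ⟨polyRes K q, ⟨q, rfl⟩⟩
  rw [this]
  exact hker _ _ (hs _)

theorem subset_polyHull {n : ℕ} {K : Set (Fin n → ℂ)} (hK : IsCompact K) : K ⊆ polyHull n K := by
  intro z hz p
  refine le_csSup ?_ ⟨z, hz, rfl⟩
  exact (hK.image (continuous_evalPoly p).norm).bddAbove

theorem isCompact_polyHull {n : ℕ} (K : Set (Fin n → ℂ)) : IsCompact (polyHull n K) := by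
  apply Metric.isCompact_of_isClosed_isBounded
  · rw [polyHull, ofPred_forall]
    exact isClosed_iInter fun p => isClosed_le (continuous_evalPoly p).norm continuous_const
  · let b : Fin n → ℝ := fun i =>
      sSup ((fun w => ‖MvPolynomial.eval w (MvPolynomial.X i : MvPolynomial (Fin n) ℂ)‖) '' K)
    refine (Metric.isBounded_closedBall (x := (0 : Fin n → ℂ)) (r := ∑ i, |b i|)).subset ?_
    intro z hz
    rw [mem_closedBall_zero_iff, pi_norm_le_iff_of_nonneg (by positivity)]
    intro i
    have h1 := hz (MvPolynomial.X i)
    rw [MvPolynomial.eval_X] at h1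
    exact (h1.trans (le_abs_self (b i))).trans
      (Finset.single_le_sum (f := fun i => |b i|) (fun _ _ => abs_nonneg _) (Finset.mem_univ i))

theorem exists_pow_add_mul_eq {R : Type*} [CommRing R] (t s q : R) (m : ℕ) :
    ∃ q', (t + s * q) ^ m = t ^ m + s * q' := by
  obtain ⟨c, hc⟩ := sub_dvd_pow_sub_pow (t + s * q) t m
  refine ⟨q * c, ?_⟩
  rw [sub_eq_iff_eq_add.1 hc]; ring

theorem norm_mul_lt_one_of_frontier {n : ℕ} {K : Set (Fin n → ℂ)} (hK : IsCompact K)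
    (hne : K.Nonempty) (P g : MvPolynomial (Fin n) ℂ) {U : Set ℂ}
    (hUb : Bornology.IsBounded U) (hUK : ∀ z ∈ K, MvPolynomial.eval z P ∉ closure U)
    {x : Fin n → ℂ} (hx : x ∈ polyHull n K) (hxU : MvPolynomial.eval x P ∈ U) {f : ℂ → ℂ}
    (hf : DiffContOnCl ℂ f U)
    (h : ∀ y ∈ polyHull n K, MvPolynomial.eval y P ∈ frontier U →
      ‖f (MvPolynomial.eval y P) * MvPolynomial.eval y g‖ < 1) :
    ‖f (MvPolynomial.eval x P) * MvPolynomial.eval x g‖ < 1 := by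
  have : CompactSpace K := isCompact_iff_compactSpace.1 hK
  have : Nonempty K := hne.to_subtype
  obtain ⟨Λ, hΛ⟩ := exists_functional_of_mem_polyHull hx
  have hfr : IsCompact (frontier U) :=
    (hUb.isCompact_closure).of_isClosed_subset isClosed_frontier frontier_subset_closure
  -- uniform power estimate on the frontier
  have key : ∃ N : ℕ, 1 ≤ N ∧ ∃ c : ℝ, 0 ≤ c ∧ c < 1 ∧ ∀ ζ ∈ frontier U,
      ∃ q : MvPolynomial (Fin n) ℂ,
        ‖polyRes K ((MvPolynomial.C (f ζ) * g) ^ N + (P - MvPolynomial.C ζ) * q)‖ ≤ c := by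
    refine hfr.induction_on (p := fun S => ∃ N : ℕ, 1 ≤ N ∧ ∃ c : ℝ, 0 ≤ c ∧ c < 1 ∧ ∀ ζ ∈ S,
      ∃ q : MvPolynomial (Fin n) ℂ,
        ‖polyRes K ((MvPolynomial.C (f ζ) * g) ^ N + (P - MvPolynomial.C ζ) * q)‖ ≤ c)
      ⟨1, le_rfl, 0, le_rfl, one_pos, by simp⟩ ?_ ?_ ?_
    · rintro S T hST ⟨N, hN, c, h0, h1, hc⟩
      exact ⟨N, hN, c, h0, h1, fun ζ hζ => hc ζ (hST hζ)⟩
    · have aux : ∀ (N m : ℕ) (c : ℝ), 1 ≤ m → 0 ≤ c → c < 1 → ∀ ζ,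
        (∃ q : MvPolynomial (Fin n) ℂ,
          ‖polyRes K ((MvPolynomial.C (f ζ) * g) ^ N + (P - MvPolynomial.C ζ) * q)‖ ≤ c) →
        (∃ q : MvPolynomial (Fin n) ℂ,
          ‖polyRes K ((MvPolynomial.C (f ζ) * g) ^ (N * m) + (P - MvPolynomial.C ζ) * q)‖ ≤ c) := by
        rintro N m c hm h0 h1 ζ ⟨q, hq⟩
        obtain ⟨q', hq'⟩ := exists_pow_add_mul_eq ((MvPolynomial.C (f ζ) * g) ^ N)
          (P - MvPolynomial.C ζ) q m
        refine ⟨q', ?_⟩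
        rw [pow_mul, ← hq', map_pow]
        calc _ ≤ _ := norm_pow_le _ _
          _ ≤ c ^ m := pow_le_pow_left₀ (norm_nonneg _) hq _
          _ ≤ c := pow_le_of_le_one h0 h1.le (by omega)
      rintro S T ⟨N, hN, c, h0, h1, hc⟩ ⟨N', hN', c', h0', h1', hc'⟩
      refine ⟨N * N', Nat.mul_pos hN hN', max c c', le_max_of_le_left h0, max_lt h1 h1', ?_⟩
      rintro ζ (hζ | hζ)
      · obtain ⟨q, hq⟩ := aux N N' c hN' h0 h1 ζ (hc ζ hζ)
        exact ⟨q, hq.trans (le_max_left _ _)⟩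
      · obtain ⟨q, hq⟩ := aux N' N c' hN h0' h1' ζ (hc' ζ hζ)
        rw [mul_comm N']at hq
        exact ⟨q, hq.trans (le_max_right _ _)⟩
    · intro ζ hζ
      obtain ⟨N, hN, q, hq⟩ := exists_eval_pow_add_mul_lt hK hne P (MvPolynomial.C (f ζ) * g) ζ
        one_pos (by
          intro y hy hyP
          have := h y hy (hyP ▸ hζ)
          simpa [hyP] using this)
      rw [one_pow] at hq
      have hlt : ‖polyRes K ((MvPolynomial.C (f ζ) * g) ^ N + (P - MvPolynomial.C ζ) * q)‖ < 1 := by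
        rw [ContinuousMap.norm_lt_iff _ one_pos]
        intro z
        have := hq z.1 z.2
        simpa using this
      have hcont : ContinuousWithinAt (fun ζ' => ‖polyRes K ((MvPolynomial.C (f ζ') * g) ^ N
          + (P - MvPolynomial.C ζ') * q)‖) (frontier U) ζ := by
        have hfc : ContinuousWithinAt f (frontier U) ζ :=
          (hf.continuousOn ζ (frontier_subset_closure hζ)).mono frontier_subset_closure
        have hC : ∀ w : ℂ, polyRes K (MvPolynomial.C w) = algebraMap ℂ C(K, ℂ) w := fun w =>
          AlgHom.commutes (polyRes K) w
        have hAc : Continuous (algebraMap ℂ C(K, ℂ)) := continuous_algebraMap _ _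
        simp only [map_add, map_mul, map_pow, map_sub, hC]
        have h2 := hAc.continuousAt.comp_continuousWithinAt hfc
        have h3 : ContinuousWithinAt (fun ζ' => algebraMap ℂ C(K, ℂ) ζ') (frontier U) ζ :=
          hAc.continuousWithinAt
        exact (((h2.mul continuousWithinAt_const).pow N).add
          ((continuousWithinAt_const.sub h3).mul continuousWithinAt_const)).norm
      obtain ⟨c, hc1, hc2⟩ := exists_between hlt
      refine ⟨_, hcont.eventually (gt_mem_nhds hc1), N, hN, c, (norm_nonneg _).trans hc1.le, hc2,
        fun ζ' hζ' => ⟨q, le_of_lt hζ'⟩⟩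
  obtain ⟨N, hN, c, hc0, hc1, hc⟩ := key
  set a := MvPolynomial.eval x P with ha
  set p := polyRes K P with hp
  have hres : closure U ⊆ resolventSet ℂ p := by
    intro ζ hζ
    by_contra hcon
    have : ζ ∈ spectrum ℂ p := hcon
    rw [ContinuousMap.spectrum_eq_range] at this
    obtain ⟨z, rfl⟩ := this
    exact hUK z.1 z.2 (by simpa [hp] using hζ)
  have hRd : ∀ ζ ∈ closure U, DifferentiableAt ℂ (resolvent p) ζ := fun ζ hζ =>
    (spectrum.hasDerivAt_resolvent_const_left (hres hζ)).differentiableAt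
  have hmul : ∀ ζ ∈ closure U, (algebraMap ℂ C(K, ℂ) ζ - p) * resolvent p ζ = 1 := fun ζ hζ =>
    Ring.mul_inverse_cancel _ (hres hζ)
  obtain ⟨B, hB⟩ := hfr.exists_bound_of_continuousOn (f := resolvent p)
    (fun ζ hζ => (hRd ζ (frontier_subset_closure hζ)).continuousAt.continuousWithinAt)
  set C := ‖Λ‖ * (‖algebraMap ℂ C(K, ℂ) a - p‖ * B) with hCdef
  have main : ∀ m : ℕ, ‖f a * MvPolynomial.eval x g‖ ^ (N * m) ≤ C * c ^ m := by
    intro m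
    let φ : ℂ → ℂ := fun ζ => f ζ ^ (N * m) *
      Λ (polyRes K (g ^ (N * m)) * ((algebraMap ℂ C(K, ℂ) a - p) * resolvent p ζ))
    have hL : ∀ ζ ∈ closure U, DifferentiableAt ℂ (fun ζ =>
        Λ (polyRes K (g ^ (N * m)) * ((algebraMap ℂ C(K, ℂ) a - p) * resolvent p ζ))) ζ := by
      intro ζ hζ
      exact Λ.differentiableAt.comp ζ (((hRd ζ hζ).const_mul _).const_mul _)
    have hφ : DiffContOnCl ℂ φ U :=
      ⟨(hf.differentiableOn.pow _).mul fun ζ hζ => (hL ζ (subset_closure hζ)).differentiableWithinAt,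
        (hf.continuousOn.pow _).mul fun ζ hζ => (hL ζ hζ).continuousAt.continuousWithinAt⟩
    have hbd : ∀ ζ ∈ frontier U, ‖φ ζ‖ ≤ C * c ^ m := by
      intro ζ hζ
      obtain ⟨q, hq⟩ := hc ζ hζ
      obtain ⟨q', hq'⟩ := exists_pow_add_mul_eq ((MvPolynomial.C (f ζ) * g) ^ N)
          (P - MvPolynomial.C ζ) q m
      have e1 : φ ζ = Λ (polyRes K (((MvPolynomial.C (f ζ) * g) ^ N
          + (P - MvPolynomial.C ζ) * q) ^ m) *
            ((algebraMap ℂ C(K, ℂ) a - p) * resolvent p ζ)) := by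
        rw [hq', ← pow_mul, map_add, add_mul, map_add]
        have z1 : Λ (polyRes K ((P - MvPolynomial.C ζ) * q') *
            ((algebraMap ℂ C(K, ℂ) a - p) * resolvent p ζ)) = 0 := by
          have : polyRes K ((P - MvPolynomial.C ζ) * q') *
            ((algebraMap ℂ C(K, ℂ) a - p) * resolvent p ζ) =
              polyRes K ((P - MvPolynomial.C a) * q') := by
            have hC : ∀ w : ℂ, polyRes K (MvPolynomial.C w) = algebraMap ℂ C(K, ℂ) w := fun w =>
              AlgHom.commutes (polyRes K) w
            have := hmul ζ (frontier_subset_closure hζ)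
            simp only [map_mul, map_sub, hC, ← hp]
            linear_combination (p - algebraMap ℂ C(K, ℂ) a) * (polyRes K q') * this
          rw [this, hΛ]
          simp [ha]
        rw [z1, add_zero, mul_pow, ← MvPolynomial.C_pow, ← MvPolynomial.smul_eq_C_mul, map_smul,
          smul_mul_assoc, map_smul]
        rfl
      rw [e1]
      calc _ ≤ ‖Λ‖ * (c ^ m * (‖algebraMap ℂ C(K, ℂ) a - p‖ * B)) := by
            refine (Λ.le_opNorm _).trans ?_
            gcongr
            refine (norm_mul_le _ _).trans ?_
            gcongr
            · rw [map_pow]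
              exact (norm_pow_le _ _).trans (pow_le_pow_left₀ (norm_nonneg _) hq _)
            · refine (norm_mul_le _ _).trans ?_
              gcongr
              exact hB ζ hζ
        _ = _ := by rw [hCdef]; ring
    have := Complex.norm_le_of_forall_mem_frontier_norm_le hUb hφ hbd (subset_closure hxU)
    have e2 : φ a = (f a * MvPolynomial.eval x g) ^ (N * m) := by
      simp only [φ]
      rw [hmul a (subset_closure hxU), mul_one, hΛ, map_pow, mul_pow]
    rw [e2, norm_pow] at this
    exact this
  by_contra hcon
  rw [not_lt] at hcon
  have hlim : Tendsto (fun m : ℕ => C * c ^ m) atTop (𝓝 (C * 0)) :=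
    (tendsto_pow_atTop_nhds_zero_of_lt_one hc0 hc1).const_mul C
  rw [mul_zero] at hlim
  have : (1:ℝ) ≤ 0 := ge_of_tendsto' hlim fun m => (one_le_pow₀ hcon).trans (main m)
  linarith

theorem exists_fiber_of_separated {n : ℕ} {K : Set (Fin n → ℂ)} (hK : IsCompact K)
    (hne : K.Nonempty) (P e : MvPolynomial (Fin n) ℂ) {U : Set ℂ} (hUo : IsOpen U)
    (hUc : IsPreconnected U) (hUK : ∀ z ∈ K, MvPolynomial.eval z P ∉ U)
    (hsep : ∀ y ∈ polyHull n K, MvPolynomial.eval y P ∈ U →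
      ‖MvPolynomial.eval y e - 1‖ ≤ 1 / 4 ∨ ‖MvPolynomial.eval y e‖ ≤ 1 / 4)
    {x : Fin n → ℂ} (hx : x ∈ polyHull n K) (hxU : MvPolynomial.eval x P ∈ U)
    (hxe : ‖MvPolynomial.eval x e - 1‖ ≤ 1 / 4) {ζ : ℂ} (hζ : ζ ∈ U) :
    ∃ y ∈ polyHull n K, MvPolynomial.eval y P = ζ ∧ ‖MvPolynomial.eval y e - 1‖ ≤ 1 / 4 := by
  set T : Set (Fin n → ℂ) := polyHull n K ∩ {y | ‖MvPolynomial.eval y e - 1‖ ≤ 1 / 4}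
  set E : Set ℂ := (fun y => MvPolynomial.eval y P) '' T
  have hTc : IsCompact T := (isCompact_polyHull K).inter_right
    (isClosed_le ((continuous_evalPoly e).sub continuous_const).norm continuous_const)
  have hEc : IsCompact E := hTc.image (continuous_evalPoly P)
  have hloc : ∀ c ∈ E, c ∈ U → E ∈ 𝓝 c := by
    intro c hcE hcU
    obtain ⟨ε, hε, hεU⟩ := Metric.nhds_basis_closedBall.mem_iff.1 (hUo.mem_nhds hcU)
    set r := ε / 4 with hr
    have hr0 : 0 < r := by positivity
    have hrU : closedBall c (4 * r) ⊆ U := by convert hεU using 2; rw [hr]; ring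
    by_contra hcon
    have : ∃ b ∈ ball c r, b ∉ E := by
      by_contra h
      push Not at h
      exact hcon (mem_of_superset (ball_mem_nhds c hr0) h)
    obtain ⟨b, hb, hbE⟩ := this
    rw [mem_ball] at hb
    obtain ⟨a, ⟨haE, hac⟩, hamin⟩ := (hEc.inter_right
      (isClosed_closedBall (x := c) (ε := 4 * r))).exists_isMinOn
      ⟨c, hcE, mem_closedBall_self (by positivity)⟩
      (f := fun w => dist w b) (by fun_prop)
    obtain ⟨x', ⟨hx'K, hx'e⟩, hx'a⟩ := haE
    have hx'a : MvPolynomial.eval x' P = a := hx'a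
    have hx'e : ‖MvPolynomial.eval x' e - 1‖ ≤ 1 / 4 := hx'e
    set s := dist a b with hs
    have hs0 : 0 < s := by
      rw [hs, dist_pos]; rintro rfl
      exact hbE ⟨x', ⟨hx'K, hx'e⟩, hx'a⟩
    have hsr : s < r := lt_of_le_of_lt
      (hamin ⟨hcE, mem_closedBall_self (by positivity)⟩) (by show dist c b < r; rwa [dist_comm])
    set V : Set ℂ := {w | s / 2 < dist w b} ∩ {w | dist w b < 2 * r}
    have hVb : Bornology.IsBounded V :=
      (Metric.isBounded_ball (x := b) (r := 2 * r)).subset fun w hw => hw.2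
    have hVo : IsOpen V := (isOpen_lt continuous_const (by fun_prop)).inter
      (isOpen_lt (by fun_prop) continuous_const)
    have hVm : ∀ w, w ∈ V ↔ s / 2 < dist w b ∧ dist w b < 2 * r := fun w => Iff.rfl
    have hVcl : ∀ w ∈ closure V, s / 2 ≤ dist w b ∧ dist w b ≤ 2 * r := by
      have : closure V ⊆ {w | s / 2 ≤ dist w b} ∩ {w | dist w b ≤ 2 * r} := by
        refine closure_minimal (fun w hw => ⟨((hVm w).1 hw).1.le, ((hVm w).1 hw).2.le⟩) ?_
        exact (isClosed_le continuous_const (by fun_prop)).inter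
          (isClosed_le (by fun_prop) continuous_const)
      exact fun w hw => this hw
    have hnear : ∀ w ∈ closure V, w ∈ closedBall c (4 * r) := by
      intro w hw
      rw [mem_closedBall]
      linarith [dist_triangle w b c, (hVcl w hw).2]
    have haV : a ∈ V := (hVm a).2 ⟨by rw [← hs]; linarith, by rw [← hs]; linarith⟩
    have hnb : ∀ w ∈ closure V, w - b ≠ 0 := by
      intro w hw h
      have := (hVcl w hw).1
      rw [dist_eq_norm, h, norm_zero] at this
      linarith
    let f : ℂ → ℂ := fun w => (4 / 3 * s : ℝ) / (w - b)
    have hfn : ∀ w, ‖f w‖ = 4 / 3 * s / dist w b := by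
      intro w
      simp only [f]
      rw [norm_div, Complex.norm_real, Real.norm_of_nonneg (by positivity), dist_eq_norm]
    have hf : DiffContOnCl ℂ f V := by
      apply DifferentiableOn.diffContOnCl
      intro w hw
      exact ((differentiableAt_const _).div (differentiableAt_id.sub_const b)
        (hnb w hw)).differentiableWithinAt
    have := norm_mul_lt_one_of_frontier hK hne P e hVb
      (fun z hz hzV => hUK z hz (hrU (hnear _ hzV))) hx'K (hx'a ▸ haV) hf (by
        intro y hy hyV
        have hycl := frontier_subset_closure hyV
        have hyV' : MvPolynomial.eval y P ∉ V := by
          rw [hVo.frontier_eq] at hyV; exact hyV.2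
        have h1 := hVcl _ hycl
        have hsy := hsep y hy (hrU (hnear _ hycl))
        rw [norm_mul, hfn]
        set d := dist (MvPolynomial.eval y P) b
        have hd0 : 0 < d := by linarith [h1.1]
        rw [div_mul_eq_mul_div, div_lt_one hd0]
        by_cases h2 : s / 2 < d
        · have h3 : d = 2 * r := le_antisymm h1.2 (not_lt.1 fun h => hyV' ((hVm _).2 ⟨h2, h⟩))
          have h4 : ‖MvPolynomial.eval y e‖ ≤ 5 / 4 := by
            rcases hsy with h | h
            · have := norm_le_insert' (MvPolynomial.eval y e) 1
              rw [norm_one] at this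
              linarith
            · linarith
          nlinarith
        · have h3 : d = s / 2 := le_antisymm (not_lt.1 h2) h1.1
          have h4 : ‖MvPolynomial.eval y e‖ ≤ 1 / 4 := by
            rcases hsy with h | h
            · exfalso
              have : s ≤ d := hamin ⟨⟨y, ⟨hy, h⟩, rfl⟩, hnear _ hycl⟩
              linarith
            · exact h
          nlinarith)
    rw [norm_mul, hfn, hx'a, ← hs, mul_div_assoc, div_self hs0.ne'] at this
    have h5 := norm_sub_norm_le (1 : ℂ) (MvPolynomial.eval x' e)
    rw [norm_sub_rev, norm_one] at h5
    linarith
  have hsub : U ⊆ interior E := by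
    refine hUc.subset_of_closure_inter_subset isOpen_interior
      ⟨MvPolynomial.eval x P, hxU, mem_interior_iff_mem_nhds.2 (hloc _ ⟨x, ⟨hx, hxe⟩, rfl⟩ hxU)⟩ ?_
    rintro c ⟨hc, hcU⟩
    exact mem_interior_iff_mem_nhds.2
      (hloc c (closure_minimal interior_subset hEc.isClosed hc) hcU)
  obtain ⟨y, ⟨hy, hye⟩, hyP⟩ := interior_subset (hsub hζ)
  exact ⟨y, hy, hyP, hye⟩

theorem exists_ball_forall_not {X : Type*} [TopologicalSpace X] {B : Set X} (hB : IsCompact B)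
    {f : X → ℂ} (hf : Continuous f) {c : ℂ} (h : ∀ y ∈ B, f y ≠ c) :
    ∃ r > 0, ∀ y, ‖f y - c‖ < r → y ∉ B := by
  have h1 : c ∈ (f '' B)ᶜ := by rintro ⟨y, hy, rfl⟩; exact h y hy rfl
  obtain ⟨r, hr, hrB⟩ := Metric.isOpen_iff.1 (hB.image hf).isClosed.isOpen_compl c h1
  refine ⟨r, hr, fun y hy hyB => ?_⟩
  exact hrB (show f y ∈ ball c r by rwa [mem_ball, dist_eq_norm]) ⟨y, hyB, rfl⟩

theorem polyHull_subset_of_arg {n : ℕ} {K : Set (Fin n → ℂ)} (hK : IsCompact K)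
    (hne : K.Nonempty) (P : MvPolynomial (Fin n) ℂ) (θ : (Fin n → ℂ) → ℝ)
    (hθ : ContinuousOn θ K)
    (hP : ∀ z ∈ K, MvPolynomial.eval z P = Complex.exp (θ z * Complex.I))
    (hF1 : ∀ x ∈ polyHull n K, ‖MvPolynomial.eval x P‖ = 1 → x ∈ K)
    (hF2 : ∀ x₀ ∈ K, ∃ e : MvPolynomial (Fin n) ℂ, ∀ y ∈ K,
      MvPolynomial.eval y P = MvPolynomial.eval x₀ P →
        (θ y = θ x₀ ∧ ‖MvPolynomial.eval y e - 1‖ < 1 / 4) ∨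
        (θ y ≠ θ x₀ ∧ ‖MvPolynomial.eval y e‖ < 1 / 4)) :
    polyHull n K ⊆ K := by
  have hX := isCompact_polyHull K
  have hP1 : ∀ z ∈ K, ‖MvPolynomial.eval z P‖ = 1 := fun z hz => by
    rw [hP z hz, Complex.norm_exp_ofReal_mul_I]
  have hle : ∀ x ∈ polyHull n K, ‖MvPolynomial.eval x P‖ ≤ 1 := by
    intro x hx
    refine (hx P).trans (csSup_le (hne.image _) ?_)
    rintro _ ⟨z, hz, rfl⟩
    exact (hP1 z hz).le
  by_contra hcon
  obtain ⟨x, hx, hxK⟩ := not_subset.1 hcon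
  have hx1 : ‖MvPolynomial.eval x P‖ < 1 :=
    lt_of_le_of_ne (hle x hx) fun h => hxK (hF1 x hx h)
  set Y : Set (Fin n → ℂ) := polyHull n K ∩ {y | ‖MvPolynomial.eval y P‖ < 1}
  have hYm : ∀ y, y ∈ Y ↔ y ∈ polyHull n K ∧ ‖MvPolynomial.eval y P‖ < 1 := fun y => Iff.rfl
  have hYX : closure Y ⊆ polyHull n K := closure_minimal inter_subset_left hX.isClosed
  have hYc : IsCompact (closure Y) := hX.of_isClosed_subset isClosed_closure hYX
  rcases (K ∩ closure Y).eq_empty_or_nonempty with hF | hF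
  · have hYcl : closure Y ⊆ Y := by
      intro y hy
      refine (hYm y).2 ⟨hYX hy, lt_of_le_of_ne (hle y (hYX hy)) fun h => ?_⟩
      have : y ∈ K ∩ closure Y := ⟨hF1 y (hYX hy) h, hy⟩
      rw [hF] at this; exact this
    obtain ⟨y0, hy0, hmax⟩ := hYc.exists_isMaxOn ⟨x, subset_closure ((hYm x).2 ⟨hx, hx1⟩)⟩
      (f := fun y => ‖MvPolynomial.eval y P‖) (continuous_evalPoly P).norm.continuousOn
    have h1 := ((hYm y0).1 (hYcl hy0)).2
    set m := ‖MvPolynomial.eval y0 P‖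
    obtain ⟨y, hy, hyP, -⟩ := exists_fiber_of_separated hK hne P 1 (isOpen_ball (x := (0:ℂ)) (ε := 1))
      (convex_ball _ _).isPreconnected (fun z hz h => by
        rw [mem_ball_zero_iff, hP1 z hz] at h; exact lt_irrefl _ h)
      (fun y _ _ => Or.inl (by simp)) hx (by rwa [mem_ball_zero_iff]) (by simp)
      (ζ := (((m + 1) / 2 : ℝ) : ℂ)) (by
        rw [mem_ball_zero_iff, Complex.norm_real, Real.norm_of_nonneg (by positivity)]
        linarith)
    have hyn : ‖MvPolynomial.eval y P‖ = (m + 1) / 2 := by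
      rw [hyP, Complex.norm_real, Real.norm_of_nonneg (by positivity)]
    have : ‖MvPolynomial.eval y P‖ ≤ m :=
      hmax (subset_closure ((hYm y).2 ⟨hy, by rw [hyn]; linarith⟩))
    linarith
  · obtain ⟨x0, ⟨hx0K, hx0Y⟩, hmax⟩ := (hK.inter_right isClosed_closure).exists_isMaxOn hF
      (hθ.mono inter_subset_left)
    obtain ⟨e, he⟩ := hF2 x0 hx0K
    set ζ0 := MvPolynomial.eval x0 P
    obtain ⟨r1, hr1, hr1'⟩ := exists_ball_forall_not (c := ζ0) (B := polyHull n K ∩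
      ({y | 1 / 4 ≤ ‖MvPolynomial.eval y e - 1‖} ∩ {y | 1 / 4 ≤ ‖MvPolynomial.eval y e‖}))
      (hX.inter_right ((isClosed_le continuous_const
        ((continuous_evalPoly e).sub continuous_const).norm).inter
        (isClosed_le continuous_const (continuous_evalPoly e).norm))) (continuous_evalPoly P) (by
        rintro y ⟨hy, hy1, hy2⟩ hyP
        have hy1 : 1 / 4 ≤ ‖MvPolynomial.eval y e - 1‖ := hy1
        have hy2 : 1 / 4 ≤ ‖MvPolynomial.eval y e‖ := hy2
        have hyK : y ∈ K := hF1 y hy (by rw [hyP, hP1 x0 hx0K])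
        rcases he y hyK hyP with h | h
        · linarith [h.2]
        · linarith [h.2])
    obtain ⟨r2, hr2, hr2'⟩ := exists_ball_forall_not (c := ζ0)
      (B := (K ∩ θ ⁻¹' {t | 1 ≤ |t - θ x0|}) ∩ {y | ‖MvPolynomial.eval y e - 1‖ ≤ 1 / 4})
      ((hK.of_isClosed_subset (hθ.preimage_isClosed_of_isClosed hK.isClosed
        (isClosed_le continuous_const (by fun_prop))) inter_subset_left).inter_right
        (isClosed_le ((continuous_evalPoly e).sub continuous_const).norm continuous_const))
      (continuous_evalPoly P) (by
        rintro y ⟨⟨hyK, hy1⟩, hy2⟩ hyP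
        have hy1 : 1 ≤ |θ y - θ x0| := hy1
        have hy2 : ‖MvPolynomial.eval y e - 1‖ ≤ 1 / 4 := hy2
        rcases he y hyK hyP with h | h
        · rw [h.1, sub_self, abs_zero] at hy1; linarith
        · have h5 := norm_sub_norm_le (1 : ℂ) (MvPolynomial.eval y e)
          rw [norm_sub_rev, norm_one] at h5
          linarith [h.2])
    set r := min r1 r2
    have hr0 : 0 < r := lt_min hr1 hr2
    have hx0e : ‖MvPolynomial.eval x0 e - 1‖ < 1 / 4 := by
      rcases he x0 hx0K rfl with h | h
      · exact h.2
      · exact absurd rfl h.1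
    have hnear : ∃ y ∈ Y, MvPolynomial.eval y P ∈ ball ζ0 r ∧ ‖MvPolynomial.eval y e - 1‖ < 1 / 4 := by
      have h1 : ∀ᶠ y in 𝓝 x0, MvPolynomial.eval y P ∈ ball ζ0 r :=
        (continuous_evalPoly P).continuousAt.eventually (ball_mem_nhds _ hr0)
      have h2 : ∀ᶠ y in 𝓝 x0, ‖MvPolynomial.eval y e - 1‖ < 1 / 4 :=
        ((continuous_evalPoly e).sub continuous_const).norm.continuousAt.eventually
          (gt_mem_nhds hx0e)
      obtain ⟨y, hy, hyY⟩ := ((mem_closure_iff_frequently.1 hx0Y).and_eventually (h1.and h2)).exists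
      exact ⟨y, hy, hyY⟩
    obtain ⟨y1, hy1Y, hy1P, hy1e⟩ := hnear
    have hcover : ∀ ζ ∈ ball ζ0 r ∩ ball (0:ℂ) 1, ζ ∈ (fun y => MvPolynomial.eval y P) ''
        (closure Y ∩ {y | ‖MvPolynomial.eval y e - 1‖ ≤ 1 / 4}) := by
      intro ζ hζ
      obtain ⟨y, hy, hyP, hye⟩ := exists_fiber_of_separated hK hne P e
        (isOpen_ball.inter isOpen_ball)
        ((convex_ball ζ0 r).inter (convex_ball (0:ℂ) 1)).isPreconnected (fun z hz h => by
          have := h.2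
          rw [mem_ball_zero_iff, hP1 z hz] at this; exact lt_irrefl _ this)
        (fun y hy hyU => by
          by_contra hcon
          rw [not_or, not_le, not_le] at hcon
          refine hr1' y ?_ ⟨hy, hcon.1.le, hcon.2.le⟩
          have := hyU.1
          rw [mem_ball, dist_eq_norm] at this
          exact this.trans_le (min_le_left _ _))
        ((hYm y1).1 hy1Y).1 ⟨hy1P, by rw [mem_ball_zero_iff]; exact ((hYm y1).1 hy1Y).2⟩
        hy1e.le hζ
      refine ⟨y, ⟨subset_closure ((hYm y).2 ⟨hy, ?_⟩), hye⟩, hyP⟩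
      rw [hyP]; exact mem_ball_zero_iff.1 hζ.2
    have hδ : ∃ δ : ℝ, 0 < δ ∧ δ < 1 ∧
        Complex.exp (((θ x0 + δ : ℝ) : ℂ) * Complex.I) ∈ ball ζ0 r := by
      have hc : Continuous fun δ : ℝ => Complex.exp (((θ x0 + δ : ℝ) : ℂ) * Complex.I) := by
        fun_prop
      have h1 : ∀ᶠ δ in 𝓝 (0:ℝ), Complex.exp (((θ x0 + δ : ℝ) : ℂ) * Complex.I) ∈ ball ζ0 r := by
        apply hc.continuousAt.eventually
        beta_reduce
        rw [add_zero, ← hP x0 hx0K]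
        exact ball_mem_nhds _ hr0
      obtain ⟨δ, h⟩ := ((h1.filter_mono nhdsWithin_le_nhds).and
        (Ioo_mem_nhdsGT (zero_lt_one (α := ℝ)))).exists
      exact ⟨δ, h.2.1, h.2.2, h.1⟩
    obtain ⟨δ, hδ0, hδ1, hδr⟩ := hδ
    set ζ1 := Complex.exp (((θ x0 + δ : ℝ) : ℂ) * Complex.I) with hζ1
    have hζ1n : ‖ζ1‖ = 1 := Complex.norm_exp_ofReal_mul_I _
    have hTc : IsCompact ((fun y => MvPolynomial.eval y P) ''
        (closure Y ∩ {y | ‖MvPolynomial.eval y e - 1‖ ≤ 1 / 4})) :=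
      (hYc.inter_right (isClosed_le ((continuous_evalPoly e).sub continuous_const).norm
        continuous_const)).image (continuous_evalPoly P)
    have hmem : ζ1 ∈ closure (ball ζ0 r ∩ ball (0:ℂ) 1) := by
      apply isOpen_ball.inter_closure
      refine ⟨hδr, ?_⟩
      rw [closure_ball _ one_ne_zero, mem_closedBall_zero_iff, hζ1n]
    obtain ⟨y, ⟨hyY, hye⟩, hyP⟩ := closure_minimal hcover hTc.isClosed hmem
    have hyP : MvPolynomial.eval y P = ζ1 := hyP
    have hye : ‖MvPolynomial.eval y e - 1‖ ≤ 1 / 4 := hye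
    have hyK : y ∈ K := hF1 y (hYX hyY) (by rw [hyP, hζ1n])
    have hyθ : |θ y - θ x0| < 1 := by
      by_contra hcon
      refine hr2' y ?_ ⟨⟨hyK, not_lt.1 hcon⟩, hye⟩
      rw [hyP]
      rw [mem_ball, dist_eq_norm] at hδr
      exact hδr.trans_le (min_le_right _ _)
    have hmaxy : θ y ≤ θ x0 := hmax ⟨hyK, hyY⟩
    have hexp := hyP.symm.trans (hP y hyK)
    rw [hζ1, Complex.exp_eq_exp_iff_exists_int] at hexp
    obtain ⟨k, hk⟩ := hexp
    have hk' : θ x0 + δ = θ y + k * (2 * Real.pi) := by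
      have := congrArg Complex.im hk
      simpa using this
    have hpi := Real.pi_gt_three
    rw [abs_lt] at hyθ
    rcases lt_trichotomy k 0 with h | h | h
    · have : (k:ℝ) ≤ -1 := by exact_mod_cast Int.le_sub_one_of_lt h
      nlinarith
    · subst h; simp at hk'; linarith
    · have : (1:ℝ) ≤ k := by exact_mod_cast h
      nlinarith

end

section

open Metric Set Filter Topology MeasureTheory

theorem setIntegral_polarCoord_symm_eq_circleAverage (g : ℂ → ℂ) (r : ℝ) :
    ∫ θ in Ioo (-Real.pi) Real.pi, g (Complex.polarCoord.symm (r, θ)) =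
      (2 * Real.pi) • Real.circleAverage g 0 r := by
  have hper : Function.Periodic (fun θ => g (circleMap 0 r θ)) (2 * Real.pi) := by
    intro θ
    show g (circleMap 0 r (θ + 2 * Real.pi)) = _
    rw [periodic_circleMap]
  have h1 := hper.intervalIntegral_add_eq (-Real.pi) 0
  rw [Real.circleAverage, smul_smul, mul_inv_cancel₀ (by positivity), one_smul,
    ← integral_Ioc_eq_integral_Ioo, ← intervalIntegral.integral_of_le (by linarith [Real.pi_pos])]
  rw [zero_add, show -Real.pi + 2 * Real.pi = Real.pi by ring] at h1
  rw [← h1]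
  refine intervalIntegral.integral_congr fun θ _ => ?_
  simp [circleMap, Complex.exp_mul_I]

theorem circleAverage_inv_sub_of_lt {w : ℂ} {r : ℝ} (hr : 0 < r) (h : r < ‖w‖) :
    Real.circleAverage (fun z => (z - w)⁻¹) 0 r = -w⁻¹ := by
  have hd : DiffContOnCl ℂ (fun z => (z - w)⁻¹) (ball 0 |r|) := by
    apply DifferentiableOn.diffContOnCl
    rw [closure_ball _ (abs_pos.2 hr.ne').ne']
    intro z hz
    refine ((differentiableAt_id.sub_const w).inv ?_).differentiableWithinAt
    intro h0
    have : z = w := sub_eq_zero.1 h0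
    rw [mem_closedBall_zero_iff, this, abs_of_pos hr] at hz
    linarith
  rw [hd.circleAverage]
  simp [inv_neg]

theorem circleAverage_inv_sub_of_gt {w : ℂ} {r : ℝ} (h : ‖w‖ < r) :
    Real.circleAverage (fun z => (z - w)⁻¹) 0 r = 0 := by
  have hr : 0 < r := (norm_nonneg w).trans_lt h
  have hne : ∀ z ∈ closedBall (0:ℂ) r, (r:ℂ) ^ 2 - (starRingEnd ℂ) w * z ≠ 0 := by
    intro z hz h0
    have h1 : (r:ℂ) ^ 2 = (starRingEnd ℂ) w * z := sub_eq_zero.1 h0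
    have h2 := congrArg norm h1
    rw [norm_pow, Complex.norm_real, norm_mul, RCLike.norm_conj, Real.norm_of_nonneg hr.le] at h2
    rw [mem_closedBall_zero_iff] at hz
    nlinarith [norm_nonneg w, norm_nonneg z]
  have hd : DiffContOnCl ℂ (fun z => z / ((r:ℂ) ^ 2 - (starRingEnd ℂ) w * z)) (ball 0 |r|) := by
    apply DifferentiableOn.diffContOnCl
    rw [closure_ball _ (abs_pos.2 hr.ne').ne', abs_of_pos hr]
    intro z hz
    have h1 : DifferentiableAt ℂ (fun z => (r:ℂ) ^ 2 - (starRingEnd ℂ) w * z) z := by fun_prop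
    exact (differentiableAt_id.div h1 (hne z hz)).differentiableWithinAt
  have h0 := hd.circleAverage
  simp only [zero_div] at h0
  have h3 : ∀ θ, (circleMap 0 r θ - w)⁻¹ = (starRingEnd ℂ)
      (circleMap 0 r θ / ((r:ℂ) ^ 2 - (starRingEnd ℂ) w * circleMap 0 r θ)) := by
    intro θ
    set z := circleMap 0 r θ with hz
    have hzn : ‖z‖ = r := by rw [hz, norm_circleMap_zero, abs_of_pos hr]
    have hzz : z * (starRingEnd ℂ) z = (r:ℂ) ^ 2 := by
      rw [Complex.mul_conj, Complex.normSq_eq_norm_sq, hzn]; push_cast; rfl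
    have hzw : z - w ≠ 0 := by
      intro h
      rw [sub_eq_zero.1 h] at hzn; linarith
    have hz0 : (starRingEnd ℂ) z ≠ 0 := by
      rw [map_ne_zero]; rintro h; rw [h, norm_zero] at hzn; linarith
    rw [map_div₀, map_sub, map_mul, Complex.conj_conj, map_pow, Complex.conj_ofReal, ← hzz]
    rw [show z * (starRingEnd ℂ) z - w * (starRingEnd ℂ) z = (starRingEnd ℂ) z * (z - w) by ring]
    field_simp
  rw [Real.circleAverage] at h0 ⊢
  rw [smul_eq_zero] at h0 ⊢
  right
  replace h0 := h0.resolve_left (by positivity)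
  simp_rw [h3]
  rw [intervalIntegral.integral_of_le (by positivity)] at h0 ⊢
  rw [integral_conj, h0, map_zero]

theorem lintegral_enorm_inv_sub (w : ℂ) {ρ : ℝ} (hρ : 0 ≤ ρ) :
    ∫⁻ ζ in ball w ρ, ‖(ζ - w)⁻¹‖ₑ = ENNReal.ofReal (2 * Real.pi * ρ) := by
  have h1 : ∫⁻ ζ in ball w ρ, ‖(ζ - w)⁻¹‖ₑ =
      ∫⁻ ζ, (ball (0:ℂ) ρ).indicator (fun ζ => ‖ζ⁻¹‖ₑ) ζ := by
    rw [← lintegral_indicator measurableSet_ball, ← lintegral_sub_right_eq_self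
      (μ := volume) ((ball (0:ℂ) ρ).indicator fun ζ => ‖ζ⁻¹‖ₑ) w]
    refine lintegral_congr fun ζ => ?_
    simp [indicator, mem_ball, dist_eq_norm]
  rw [h1, ← Complex.lintegral_comp_polarCoord_symm]
  have h2 : ∀ p ∈ polarCoord.target, ENNReal.ofReal p.1 •
      (ball (0:ℂ) ρ).indicator (fun ζ => ‖ζ⁻¹‖ₑ) (Complex.polarCoord.symm p) =
      (Ioo 0 ρ ×ˢ Ioo (-Real.pi) Real.pi).indicator 1 p := by
    intro p hp
    rw [polarCoord_target] at hp
    have hp1 : 0 < p.1 := hp.1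
    by_cases h : p.1 < ρ
    · have hmem : p ∈ Ioo 0 ρ ×ˢ Ioo (-Real.pi) Real.pi := ⟨⟨hp1, h⟩, hp.2⟩
      rw [indicator_of_mem, indicator_of_mem hmem]
      · rw [← ofReal_norm, norm_inv, Complex.norm_polarCoord_symm, abs_of_pos hp1,
          smul_eq_mul, ← ENNReal.ofReal_mul hp1.le, mul_inv_cancel₀ hp1.ne']
        simp
      · rwa [mem_ball_zero_iff, Complex.norm_polarCoord_symm, abs_of_pos hp1]
    · rw [indicator_of_notMem, indicator_of_notMem]
      · simp
      · exact fun hh => h hh.1.2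
      · rwa [mem_ball_zero_iff, Complex.norm_polarCoord_symm, abs_of_pos hp1]
  rw [setLIntegral_congr_fun polarCoord.open_target.measurableSet h2,
    lintegral_indicator_one (measurableSet_Ioo.prod measurableSet_Ioo),
    Measure.restrict_apply (measurableSet_Ioo.prod measurableSet_Ioo), inter_eq_self_of_subset_left]
  · rw [Measure.volume_eq_prod, Measure.prod_prod, Real.volume_Ioo, Real.volume_Ioo,
      ← ENNReal.ofReal_mul (by simpa using hρ)]
    congr 1; ring
  · rw [polarCoord_target]
    exact prod_mono (fun x hx => hx.1) subset_rfl

theorem integrableOn_inv_sub (w : ℂ) {s : Set ℂ} (hs : Bornology.IsBounded s) :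
    IntegrableOn (fun ζ : ℂ => (ζ - w)⁻¹) s := by
  obtain ⟨ρ, hρ, hsρ⟩ := hs.subset_ball_lt 0 w
  refine IntegrableOn.mono_set ⟨by fun_prop, ?_⟩ hsρ
  rw [HasFiniteIntegral, lintegral_enorm_inv_sub w hρ.le]
  exact ENNReal.ofReal_lt_top

theorem integral_ball_inv_sub {w : ℂ} {R : ℝ} (h : ‖w‖ < R) :
    ∫ ζ in ball (0:ℂ) R, (ζ - w)⁻¹ = -Real.pi * (starRingEnd ℂ) w := by
  set f : ℂ → ℂ := (ball (0:ℂ) R).indicator (fun ζ => (ζ - w)⁻¹) with hf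
  have hfi : Integrable f := (integrable_indicator_iff measurableSet_ball).2
    (integrableOn_inv_sub w isBounded_ball)
  have hfm : Measurable f := (by fun_prop : Measurable fun ζ : ℂ => (ζ - w)⁻¹).indicator
    measurableSet_ball
  have hpm : Measurable fun p : ℝ × ℝ => Complex.polarCoord.symm p := by
    simp_rw [Complex.polarCoord_symm_apply]
    fun_prop
  have h_int : IntegrableOn (fun p : ℝ × ℝ => p.1 • f (Complex.polarCoord.symm p))
      (Ioi (0:ℝ) ×ˢ Ioo (-Real.pi) Real.pi) := by
    refine ⟨(measurable_fst.smul (hfm.comp hpm)).aestronglyMeasurable, ?_⟩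
    have := hfi.2
    rw [HasFiniteIntegral, ← Complex.lintegral_comp_polarCoord_symm, polarCoord_target] at this
    rw [HasFiniteIntegral]
    convert this using 1
    refine setLIntegral_congr_fun (measurableSet_Ioi.prod measurableSet_Ioo) fun p hp => ?_
    have hp1 : 0 < p.1 := hp.1
    simp only [enorm_smul, smul_eq_mul]
    rw [← ofReal_norm p.1, Real.norm_of_nonneg hp1.le]
  rw [← integral_indicator measurableSet_ball, ← hf, ← Complex.integral_comp_polarCoord_symm,
    polarCoord_target, Measure.volume_eq_prod, setIntegral_prod _ h_int]
  have hinner : ∀ r ∈ Ioi (0:ℝ), r ≠ ‖w‖ → ∫ θ in Ioo (-Real.pi) Real.pi,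
      (r, θ).1 • f (Complex.polarCoord.symm (r, θ)) =
      (Ioo 0 ‖w‖).indicator (fun r : ℝ => ((-(2 * Real.pi) * r : ℝ) : ℂ) * w⁻¹) r := by
    intro r hr hrw
    have hr : 0 < r := hr
    simp only
    rw [integral_smul, setIntegral_polarCoord_symm_eq_circleAverage]
    by_cases hrR : r < R
    · have hav : Real.circleAverage f 0 r = Real.circleAverage (fun z => (z - w)⁻¹) 0 r := by
        apply Real.circleAverage_congr_sphere
        intro z hz
        rw [mem_sphere_zero_iff_norm, abs_of_pos hr] at hz
        rw [hf]
        exact indicator_of_mem (by rwa [mem_ball_zero_iff, hz]) _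
      rw [hav]
      rcases lt_or_gt_of_ne hrw with h1 | h1
      · have hmem : r ∈ Ioo 0 ‖w‖ := ⟨hr, h1⟩
        rw [circleAverage_inv_sub_of_lt hr h1, indicator_of_mem hmem]
        simp only [Complex.real_smul]
        push_cast; ring
      · rw [circleAverage_inv_sub_of_gt h1, indicator_of_notMem (fun hh => by linarith [hh.2])]
        simp
    · have hav : Real.circleAverage f 0 r = Real.circleAverage (fun z => 0) 0 r := by
        apply Real.circleAverage_congr_sphere
        intro z hz
        rw [mem_sphere_zero_iff_norm, abs_of_pos hr] at hz
        rw [hf]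
        exact indicator_of_notMem (by rw [mem_ball_zero_iff, hz]; exact hrR) _
      rw [hav, indicator_of_notMem (fun hh => by linarith [hh.2])]
      simp [Real.circleAverage]
  have hae : ∀ᵐ r : ℝ, r ≠ ‖w‖ := by
    rw [ae_iff]; simp
  rw [setIntegral_congr_ae (g := (Ioo 0 ‖w‖).indicator
      (fun r : ℝ => ((-(2 * Real.pi) * r : ℝ) : ℂ) * w⁻¹)) measurableSet_Ioi
    (hae.mono fun r hr hr2 => hinner r hr2 hr), setIntegral_indicator measurableSet_Ioo,
    inter_eq_self_of_subset_right (fun x hx => hx.1), integral_mul_const, integral_complex_ofReal,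
    ← integral_Ioc_eq_integral_Ioo, ← intervalIntegral.integral_of_le (norm_nonneg w)]
  rw [intervalIntegral.integral_const_mul, integral_id]
  rcases eq_or_ne w 0 with rfl | hw
  · simp
  · have : w * (starRingEnd ℂ) w = (‖w‖:ℂ) ^ 2 := by
      rw [Complex.mul_conj, Complex.normSq_eq_norm_sq]; push_cast; rfl
    field_simp
    push_cast
    linear_combination Real.pi * this

theorem lintegral_enorm_inv_sub_le (w : ℂ) {ρ : ℝ} (hρ : 0 < ρ) (A : Set ℂ) :
    ∫⁻ ζ in A, ‖(ζ - w)⁻¹‖ₑ ≤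
      ENNReal.ofReal (2 * Real.pi * ρ) + ENNReal.ofReal ρ⁻¹ * volume A := by
  rw [← lintegral_inter_add_sdiff (μ := volume) (fun ζ : ℂ => ‖(ζ - w)⁻¹‖ₑ) A
    (measurableSet_ball (x := w) (ε := ρ))]
  gcongr
  · rw [← lintegral_enorm_inv_sub w hρ.le]
    exact lintegral_mono_set inter_subset_right
  · refine (lintegral_mono_ae (g := fun _ => ENNReal.ofReal ρ⁻¹) ?_).trans ?_
    · have h1 : ∀ᵐ ζ : ℂ ∂(volume.restrict (ball w ρ)ᶜ), ‖(ζ - w)⁻¹‖ₑ ≤ ENNReal.ofReal ρ⁻¹ := by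
        refine (ae_restrict_iff' measurableSet_ball.compl).2 (Eventually.of_forall fun ζ hζ => ?_)
        have hζ' : ρ ≤ ‖ζ - w‖ := by
          rw [← dist_eq_norm]
          exact not_lt.1 hζ
        rw [← ofReal_norm, norm_inv]
        exact ENNReal.ofReal_le_ofReal (inv_anti₀ hρ hζ')
      exact ae_mono (Measure.restrict_mono (fun x hx => hx.2) le_rfl) h1
    · rw [lintegral_const, Measure.restrict_apply_univ]
      gcongr
      exact sdiff_subset

theorem exists_lintegral_cthickening_le {S : Set ℂ} (hS : IsCompact S) (hS0 : volume S = 0)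
    {η : ℝ} (hη : 0 < η) :
    ∃ ε > 0, ∀ w, ∫⁻ ζ in cthickening ε S, ‖(ζ - w)⁻¹‖ₑ ≤ ENNReal.ofReal η := by
  set ρ : ℝ := η / (4 * Real.pi) with hρ
  have hρ0 : 0 < ρ := by have := Real.pi_pos; positivity
  have h1 := tendsto_measure_cthickening_of_isCompact (μ := volume) hS
  rw [hS0] at h1
  have h2 : ∀ᶠ r in 𝓝 (0:ℝ), volume (cthickening r S) < ENNReal.ofReal (ρ * η / 2) :=
    h1.eventually (gt_mem_nhds (by simp; positivity))
  obtain ⟨ε, hε, hε0⟩ := ((h2.filter_mono nhdsWithin_le_nhds).and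
    (self_mem_nhdsWithin (s := Ioi (0:ℝ)))).exists
  refine ⟨ε, hε0, fun w => (lintegral_enorm_inv_sub_le w hρ0 _).trans ?_⟩
  calc _ ≤ ENNReal.ofReal (2 * Real.pi * ρ) + ENNReal.ofReal ρ⁻¹ * ENNReal.ofReal (ρ * η / 2) := by
        gcongr
    _ = ENNReal.ofReal η := by
        rw [← ENNReal.ofReal_mul (by positivity), ← ENNReal.ofReal_add (by have := Real.pi_pos; positivity) (by positivity)]
        congr 1
        rw [hρ]
        have := Real.pi_pos
        field_simp
        ring

theorem exists_resolvent_mem_closure {n : ℕ} {L : Set (Fin n → ℂ)} [CompactSpace L] (hne : L.Nonempty)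
    (hL : polyHull n L ⊆ L) (f : MvPolynomial (Fin n) ℂ) {ζ : ℂ}
    (hζ : ∀ z ∈ L, MvPolynomial.eval z f ≠ ζ) (R : C(L, ℂ))
    (hR : ∀ z, R z = (MvPolynomial.eval z.1 f - ζ)⁻¹) :
    R ∈ (polyRes L).range.topologicalClosure := by
  change R ∈ closure ((polyRes L).range : Set C(L, ℂ))
  rw [Metric.mem_closure_iff]
  intro ε hε
  set ρ := min 1 (ε / (‖R‖ + 1))
  have hρ0 : 0 < ρ := by positivity
  obtain ⟨N, hN, q, hq⟩ := exists_eval_pow_add_mul_lt (isCompact_iff_compactSpace.2 ‹_›) hne f 1 ζ hρ0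
    (fun y hy h => absurd h (hζ y (hL hy)))
  refine ⟨polyRes L (-q), ⟨-q, rfl⟩, ?_⟩
  rw [dist_eq_norm, ContinuousMap.norm_lt_iff _ hε]
  intro z
  have h1 := hq z.1 z.2
  have h2 : MvPolynomial.eval z.1 f - ζ ≠ 0 := sub_ne_zero.2 (hζ z.1 z.2)
  have h3 : (R - polyRes L (-q)) z = R z * (MvPolynomial.eval z.1 1 ^ N +
      (MvPolynomial.eval z.1 f - ζ) * MvPolynomial.eval z.1 q) := by
    simp [hR]
    field_simp
  rw [h3, norm_mul]
  have h4 : ρ ^ N ≤ ρ := pow_le_of_le_one hρ0.le (min_le_left _ _) (by omega)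
  calc _ ≤ ‖R‖ * ρ := by
        gcongr
        · exact R.norm_coe_le_norm z
        · exact h1.le.trans h4
    _ ≤ ‖R‖ * (ε / (‖R‖ + 1)) := by gcongr; exact min_le_right _ _
    _ < ε := by
        rw [mul_div_assoc', div_lt_iff₀ (by positivity)]
        nlinarith

theorem star_mem_closure_of_null {n : ℕ} {L : Set (Fin n → ℂ)} [CompactSpace L] (hne : L.Nonempty)
    (hL : polyHull n L ⊆ L) (f : MvPolynomial (Fin n) ℂ)
    (h0 : volume ((fun z => MvPolynomial.eval z f) '' L) = 0) :
    star (polyRes L f) ∈ (polyRes L).range.topologicalClosure := by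
  set S := (fun z => MvPolynomial.eval z f) '' L
  have hS : IsCompact S := (isCompact_iff_compactSpace.2 ‹_›).image (continuous_evalPoly f)
  have hSne : S.Nonempty := hne.image _
  obtain ⟨R, hRpos, hSR⟩ := hS.isBounded.subset_ball_lt 0 0
  set M := (polyRes L).range.topologicalClosure
  have hMc : IsClosed (M : Set C(L, ℂ)) := Subalgebra.isClosed_topologicalClosure _
  suffices h : ∀ η : ℝ, 0 < η → ∃ g ∈ M, dist (star (polyRes L f)) g ≤ η by
    rw [← SetLike.mem_coe, ← hMc.closure_eq, Metric.mem_closure_iff]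
    intro ε hε
    obtain ⟨g, hg, hd⟩ := h (ε / 2) (by positivity)
    exact ⟨g, hg, by linarith⟩
  intro η hη
  obtain ⟨ε, hε, hεS⟩ := exists_lintegral_cthickening_le hS h0 (η := Real.pi * η)
    (by have := Real.pi_pos; positivity)
  set T : Set ℂ := closedBall 0 R ∩ {ζ | ε ≤ infDist ζ S}
  set T' : Set ℂ := ball 0 R ∩ {ζ | ε ≤ infDist ζ S}
  have hclosed : IsClosed {ζ : ℂ | ε ≤ infDist ζ S} :=
    isClosed_le continuous_const (continuous_infDist_pt S)
  have hTc : IsCompact T := (isCompact_closedBall 0 R).inter_right hclosed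
  have hTT : T' ⊆ T := inter_subset_inter_left _ ball_subset_closedBall
  have hT'm : MeasurableSet T' := measurableSet_ball.inter hclosed.measurableSet
  set r : ℂ → C(L, ℂ) := fun ζ => Ring.inverse (polyRes L f - algebraMap ℂ C(L, ℂ) ζ)
  have hTS : ∀ ζ ∈ T, ∀ z ∈ L, MvPolynomial.eval z f ≠ ζ := by
    intro ζ hζ z hz h
    have h1 : ε ≤ infDist ζ S := hζ.2
    have h2 : ζ ∈ S := ⟨z, hz, h⟩
    rw [infDist_zero_of_mem h2] at h1
    linarith
  have hunit : ∀ ζ ∈ T, IsUnit (polyRes L f - algebraMap ℂ C(L, ℂ) ζ) := by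
    intro ζ hζ
    rw [ContinuousMap.isUnit_iff_forall_ne_zero]
    intro z
    simpa using sub_ne_zero.2 (hTS ζ hζ z.1 z.2)
  have hrz : ∀ ζ ∈ T, ∀ z : L, r ζ z = (MvPolynomial.eval z.1 f - ζ)⁻¹ := by
    intro ζ hζ z
    have h1 := congrArg (fun g : C(L, ℂ) => g z) (Ring.mul_inverse_cancel _ (hunit ζ hζ))
    simp only [ContinuousMap.mul_apply, ContinuousMap.one_apply] at h1
    refine eq_inv_of_mul_eq_one_right ?_
    simpa using h1
  have hrM : ∀ ζ ∈ T, r ζ ∈ M := fun ζ hζ =>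
    exists_resolvent_mem_closure hne hL f (hTS ζ hζ) (r ζ) (hrz ζ hζ)
  have hrc : ContinuousOn r T := by
    intro ζ hζ
    obtain ⟨u, hu⟩ := hunit ζ hζ
    have h1 := NormedRing.inverse_continuousAt u
    rw [hu] at h1
    have h2 : ContinuousAt (fun ζ => polyRes L f - algebraMap ℂ C(L, ℂ) ζ) ζ :=
      (continuous_const.sub (algebraMapCLM ℂ C(L, ℂ)).continuous).continuousAt
    exact (ContinuousAt.comp (f := fun ζ => polyRes L f - algebraMap ℂ C(L, ℂ) ζ) h1 h2).continuousWithinAt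
  have hri : IntegrableOn r T' := (hrc.integrableOn_compact hTc).mono_set hTT
  have hIM : ∫ ζ in T', r ζ ∈ M := by
    by_cases hv : volume T' = 0
    · rw [setIntegral_measure_zero _ hv]; exact zero_mem _
    · have hfin : volume T' ≠ ⊤ := (measure_mono hTT).trans_lt hTc.measure_lt_top |>.ne
      have hav := Convex.set_average_mem (s := (M : Set C(L, ℂ))) (μ := volume) (t := T') (f := r)
        (by
          intro a ha b hb s t _ _ _
          have : s • a + t • b = (s : ℂ) • a + (t : ℂ) • b := by simp
          rw [this]
          exact add_mem (M.smul_mem ha _) (M.smul_mem hb _)) hMc hv hfin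
        ((ae_restrict_iff' hT'm).2 (Eventually.of_forall fun ζ hζ => hrM ζ (hTT hζ))) hri
      have := measure_smul_setAverage r hfin
      rw [← this]
      have h3 : volume.real T' • (⨍ x in T', r x) = ((volume.real T' : ℝ) : ℂ) • ⨍ x in T', r x := by
        simp
      rw [h3]
      exact M.smul_mem hav _
  refine ⟨(Real.pi : ℂ)⁻¹ • ∫ ζ in T', r ζ, M.smul_mem hIM _, ?_⟩
  rw [ContinuousMap.dist_le hη.le]
  intro z
  set w := MvPolynomial.eval z.1 f with hw
  have hwR : ‖w‖ < R := by simpa using hSR ⟨z.1, z.2, rfl⟩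
  have heval : (∫ ζ in T', r ζ) z = ∫ ζ in T', (w - ζ)⁻¹ := by
    have := (ContinuousMap.evalCLM ℂ z : C(L, ℂ) →L[ℂ] ℂ).integral_comp_comm hri
    rw [ContinuousMap.evalCLM_apply] at this
    rw [← this]
    exact setIntegral_congr_fun hT'm fun ζ hζ => hrz ζ (hTT hζ) z
  have hsub : T' ⊆ ball 0 R := inter_subset_left
  have hdiff := setIntegral_sdiff hT'm (integrableOn_inv_sub w (isBounded_ball (x := (0:ℂ)) (r := R))) hsub
  rw [integral_ball_inv_sub hwR] at hdiff
  have hbound : ‖∫ ζ in ball (0:ℂ) R \ T', (ζ - w)⁻¹‖ ≤ Real.pi * η := by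
    have hpe : 0 ≤ Real.pi * η := by have := Real.pi_pos; positivity
    rw [← ENNReal.ofReal_le_ofReal_iff hpe, ofReal_norm]
    refine (enorm_integral_le_lintegral_enorm _).trans (le_trans ?_ (hεS w))
    apply lintegral_mono_set
    intro ζ hζ
    apply thickening_subset_cthickening
    rw [mem_thickening_iff_infDist_lt hSne]
    by_contra hcon
    exact hζ.2 ⟨hζ.1, not_lt.1 hcon⟩
  have hneg : ∫ ζ in T', (w - ζ)⁻¹ = - ∫ ζ in T', (ζ - w)⁻¹ := by
    rw [← integral_neg]
    congr 1; ext ζ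
    rw [← inv_neg, neg_sub]
  have hfinal : star (polyRes L f) z - ((Real.pi : ℂ)⁻¹ • ∫ ζ in T', r ζ) z =
      -(Real.pi : ℂ)⁻¹ * ∫ ζ in ball (0:ℂ) R \ T', (ζ - w)⁻¹ := by
    rw [ContinuousMap.smul_apply, heval, hneg, hdiff, ContinuousMap.star_apply, polyRes_apply, ← hw,
      smul_eq_mul]
    simp only [RCLike.star_def]
    field_simp
    ring
  rw [dist_eq_norm, hfinal, norm_mul, norm_neg, norm_inv, Complex.norm_real,
    Real.norm_of_nonneg Real.pi_pos.le, inv_mul_le_iff₀ Real.pi_pos]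
  exact hbound

theorem closure_polyRes_eq_top {n : ℕ} {L : Set (Fin n → ℂ)} [CompactSpace L] (hne : L.Nonempty)
    (hL : polyHull n L ⊆ L) (h0 : ∀ i, volume ((fun z => z i) '' L) = 0) :
    (polyRes L).range.topologicalClosure = ⊤ := by
  set M := (polyRes L).range.topologicalClosure
  have hX : ∀ i, star (polyRes L (MvPolynomial.X i)) ∈ M := fun i =>
    star_mem_closure_of_null hne hL _ (by simpa using h0 i)
  have hstar1 : ∀ q, star (polyRes L q) ∈ M := by
    intro q
    induction q using MvPolynomial.induction_on with
    | C a =>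
      have : star (polyRes L (MvPolynomial.C a)) = polyRes L (MvPolynomial.C (star a)) := by
        ext z; simp
      rw [this]
      exact Subalgebra.le_topologicalClosure _ ⟨_, rfl⟩
    | add p q hp hq => rw [map_add, star_add]; exact add_mem hp hq
    | mul_X p i hp => rw [map_mul, star_mul]; exact mul_mem (hX i) hp
  have hstar : ∀ g ∈ M, star g ∈ M := by
    intro g hg
    have hcl : IsClosed {g : C(L, ℂ) | star g ∈ M} :=
      (Subalgebra.isClosed_topologicalClosure (polyRes L).range).preimage continuous_star
    have : closure ((polyRes L).range : Set C(L, ℂ)) ⊆ {g : C(L, ℂ) | star g ∈ M} := by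
      apply closure_minimal _ hcl
      rintro _ ⟨q, rfl⟩
      exact hstar1 q
    exact this hg
  let A : StarSubalgebra ℂ C(L, ℂ) := { M with star_mem' := fun {a} ha => hstar a ha }
  have hsep : A.SeparatesPoints := by
    intro x y hxy
    have : ∃ i, x.1 i ≠ y.1 i := by
      by_contra h
      push Not at h
      exact hxy (Subtype.ext (funext h))
    obtain ⟨i, hi⟩ := this
    refine ⟨_, ⟨polyRes L (MvPolynomial.X i), Subalgebra.le_topologicalClosure _ ⟨_, rfl⟩, rfl⟩, ?_⟩
    simpa using hi
  have h1 := ContinuousMap.starSubalgebra_topologicalClosure_eq_top_of_separatesPoints A hsep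
  rw [eq_top_iff]
  intro g _
  have hg : g ∈ A.topologicalClosure := by rw [h1]; trivial
  have hAc : IsClosed (A : Set C(L, ℂ)) := Subalgebra.isClosed_topologicalClosure (polyRes L).range
  have : g ∈ closure (A : Set C(L, ℂ)) := hg
  rw [hAc.closure_eq] at this
  exact this

theorem exists_eval_near_indicator {n : ℕ} {L : Set (Fin n → ℂ)} (hLc : IsCompact L)
    (hne : L.Nonempty) (hL : polyHull n L ⊆ L) (h0 : ∀ i, volume ((fun z => z i) '' L) = 0)
    {χ : (Fin n → ℂ) → ℂ} (hχ : ContinuousOn χ L) {ε : ℝ} (hε : 0 < ε) :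
    ∃ e : MvPolynomial (Fin n) ℂ, ∀ z ∈ L, ‖MvPolynomial.eval z e - χ z‖ < ε := by
  have : CompactSpace L := isCompact_iff_compactSpace.1 hLc
  let g : C(L, ℂ) := ⟨L.domRestrict χ, hχ.domRestrict⟩
  have hg : g ∈ closure ((polyRes L).range : Set C(L, ℂ)) := by
    have : g ∈ (polyRes L).range.topologicalClosure := by
      rw [closure_polyRes_eq_top hne hL h0]; trivial
    exact this
  obtain ⟨_, ⟨e, rfl⟩, he⟩ := Metric.mem_closure_iff.1 hg ε hε
  refine ⟨e, fun z hz => ?_⟩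
  rw [dist_comm, dist_eq_norm, ContinuousMap.norm_lt_iff _ hε] at he
  have := he ⟨z, hz⟩
  rw [ContinuousMap.sub_apply] at this
  change ‖polyRes L e ⟨z, hz⟩ - χ z‖ < ε at this
  rwa [polyRes_apply] at this

end

section

open Metric Set Filter Topology

theorem Convex.exists_continuousOn_log {s : Set (ℝ × ℝ)} (hs : Convex ℝ s) (hso : IsOpen s)
    {E : ℝ × ℝ → ℂ} (hE : ContinuousOn E s) (hE0 : ∀ q ∈ s, E q ≠ 0) :
    ∃ H : ℝ × ℝ → ℂ, ContinuousOn H s ∧ ∀ q ∈ s, Complex.exp (H q) = E q := by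
  rcases s.eq_empty_or_nonempty with rfl | hne
  · exact ⟨0, by simp, by simp⟩
  obtain ⟨q0, hq0⟩ := hne
  have : ContractibleSpace s := hs.contractibleSpace ⟨q0, hq0⟩
  have : SimplyConnectedSpace s := SimplyConnectedSpace.ofContractible s
  have : LocallyPathConnectedSpace s := hso.locallyPathConnectedSpace
  let f : C(s, {z : ℂ // z ≠ 0}) := ⟨fun q => ⟨E q.1, hE0 q.1 q.2⟩,
    (continuousOn_iff_continuous_domRestrict.1 hE).subtype_mk _⟩
  obtain ⟨F, ⟨_, hF⟩, _⟩ := Complex.isCoveringMap_exp.existsUnique_continuousMap_lifts f ⟨q0, hq0⟩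
    (Complex.log (E q0)) (Subtype.ext (Complex.exp_log (hE0 q0 hq0)))
  classical
  refine ⟨fun q => if h : q ∈ s then F ⟨q, h⟩ else 0, ?_, fun q hq => ?_⟩
  · rw [continuousOn_iff_continuous_domRestrict]
    convert F.continuous using 1
    ext q
    simp [domRestrict]
  · have := congrArg Subtype.val (congrFun hF ⟨q, hq⟩)
    simp only [hq, dif_pos]
    exact this

/-- A continuous function on a disc without local extrema has no compact isolated piece of a
level set. -/
theorem eq_empty_of_isolated_level {R' : ℝ} {θ : ℝ × ℝ → ℝ} (hθ : ContinuousOn θ (ball 0 R'))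
    (hmax : ∀ q ∈ ball (0 : ℝ × ℝ) R', ¬ IsLocalMax θ q)
    (hmin : ∀ q ∈ ball (0 : ℝ × ℝ) R', ¬ IsLocalMin θ q) {C : Set (ℝ × ℝ)} (hC : IsCompact C)
    (hCs : C ⊆ ball 0 R') (hopen : ∀ q0 ∈ C, ∀ᶠ q in 𝓝 q0, θ q = θ q0 → q ∈ C) : C = ∅ := by
  by_contra hne
  obtain ⟨q0, hq0⟩ := nonempty_iff_ne_empty.2 hne
  set t := θ q0
  set C1 := C ∩ {q | θ q = t}
  have hC1c : IsCompact C1 := by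
    have := (hθ.mono hCs).preimage_isClosed_of_isClosed hC.isClosed (isClosed_singleton (x := t))
    exact hC.of_isClosed_subset this inter_subset_left
  obtain ⟨W, hWo, hC1W, hW⟩ : ∃ W, IsOpen W ∧ C1 ⊆ W ∧ ∀ q ∈ W, θ q = t → q ∈ C1 := by
    have h1 : ∀ q ∈ C1, ∀ᶠ q' in 𝓝 q, θ q' = t → q' ∈ C1 := by
      rintro q ⟨hq, hqt⟩
      have hqt : θ q = t := hqt
      filter_upwards [hopen q hq] with q' hq' ht'
      exact ⟨hq' (ht'.trans hqt.symm), ht'⟩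
    refine ⟨interior {q | θ q = t → q ∈ C1}, isOpen_interior, fun q hq => ?_, fun q hq => ?_⟩
    · exact mem_interior_iff_mem_nhds.2 (h1 q hq)
    · exact interior_subset hq
  obtain ⟨G, hGo, hC1G, hGW, hGc⟩ := exists_open_between_and_isCompact_closure hC1c
    (hWo.inter isOpen_ball) (subset_inter hC1W (inter_subset_left.trans hCs))
  have hGball : closure G ⊆ ball 0 R' := hGW.trans inter_subset_right
  have hfr : ∀ q ∈ frontier G, θ q ≠ t := by
    intro q hq h
    have h1 := hW q (hGW hq.1).1 h
    rw [hGo.frontier_eq] at hq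
    exact hq.2 (hC1G h1)
  -- a margin on the frontier
  obtain ⟨δ, hδ, hδfr⟩ : ∃ δ > 0, ∀ q ∈ frontier G, δ < |θ q - t| := by
    rcases (frontier G).eq_empty_or_nonempty with h | h
    · exact ⟨1, one_pos, by simp [h]⟩
    · have hfc : IsCompact (frontier G) := hGc.of_isClosed_subset isClosed_frontier
        (fun x hx => hx.1)
      have hcont : ContinuousOn (fun q => |θ q - t|) (frontier G) :=
        ((hθ.mono (fun x hx => hGball hx.1)).sub continuousOn_const).abs
      obtain ⟨x, hx, hxm⟩ := hfc.exists_isMinOn h hcont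
      have hpos : 0 < |θ x - t| := abs_pos.2 (sub_ne_zero.2 (hfr x hx))
      refine ⟨|θ x - t| / 2, by positivity, fun q hq => ?_⟩
      have := isMinOn_iff.1 hxm q hq
      linarith
  -- the clamped phase
  let c : ℝ → ℝ := fun u => max 0 (min 1 (((u - t) / δ + 1) / 2))
  have hcc : Continuous c := by fun_prop
  have hcmono : Monotone c := by
    intro a b hab
    simp only [c]
    gcongr
  let e : ℝ → ℂ := fun u => Complex.exp ((2 * Real.pi * c u : ℝ) * Complex.I)
  have hec : Continuous e := by fun_prop
  have he1 : ∀ u, δ ≤ |u - t| → e u = 1 := by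
    intro u hu
    rcases le_abs'.1 hu with h | h
    · have : c u = 0 := by
        have : ((u - t) / δ + 1) / 2 ≤ 0 := by
          have : (u - t) / δ ≤ -1 := by rw [div_le_iff₀ hδ]; linarith
          linarith
        simp only [c]
        rw [max_eq_left]
        exact (min_le_right _ _).trans this
      simp [e, this]
    · have : c u = 1 := by
        have : 1 ≤ ((u - t) / δ + 1) / 2 := by
          have : 1 ≤ (u - t) / δ := by rw [le_div_iff₀ hδ]; linarith
          linarith
        simp only [c]
        rw [min_eq_left this]; simp
      simp [e, this, Complex.exp_two_pi_mul_I]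
  classical
  let E : ℝ × ℝ → ℂ := fun q => if q ∈ G then e (θ q) else 1
  have hEnot : ∀ q, q ∉ G → ∀ᶠ q' in 𝓝 q, E q' = 1 := by
    intro q hq
    by_cases hqc : q ∈ closure G
    · have hqf : q ∈ frontier G := by rw [hGo.frontier_eq]; exact ⟨hqc, hq⟩
      have hcont : ContinuousAt (fun q => |θ q - t|) q :=
        ((hθ.continuousAt (isOpen_ball.mem_nhds (hGball hqc))).sub continuousAt_const).abs
      filter_upwards [hcont.eventually (lt_mem_nhds (hδfr q hqf))] with q' hq'
      simp only [E]
      split_ifs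
      · exact he1 _ hq'.le
      · rfl
    · filter_upwards [isClosed_closure.isOpen_compl.mem_nhds hqc] with q' hq'
      exact if_neg fun h => hq' (subset_closure h)
  have hEc : Continuous E := by
    rw [continuous_iff_continuousAt]
    intro q
    by_cases hq : q ∈ G
    · have h1 : E =ᶠ[𝓝 q] fun q => e (θ q) := by
        filter_upwards [hGo.mem_nhds hq] with q' hq'
        exact if_pos hq'
      refine ContinuousAt.congr ?_ h1.symm
      exact hec.continuousAt.comp
        (hθ.continuousAt (isOpen_ball.mem_nhds (hGball (subset_closure hq))))
    · have h1 : E =ᶠ[𝓝 q] fun _ => 1 := hEnot q hq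
      exact continuousAt_const.congr h1.symm
  have hEn : ∀ q, ‖E q‖ = 1 := by
    intro q
    simp only [E]
    split_ifs
    · simp only [e]; rw [Complex.norm_exp_ofReal_mul_I]
    · simp
  obtain ⟨H, hH, hHE⟩ := convex_univ.exists_continuousOn_log isOpen_univ hEc.continuousOn
    (fun q _ h => by have := hEn q; rw [h] at this; simp at this)
  rw [continuousOn_univ] at hH
  let S : ℝ × ℝ → ℝ := fun q => (H q).im
  have hS : Continuous S := Complex.continuous_im.comp hH
  have hSE : ∀ q, Complex.exp (S q * Complex.I) = E q := by
    intro q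
    rw [← hHE q trivial]
    have h1 : (H q).re = 0 := by
      have := hEn q
      rw [← hHE q trivial, Complex.norm_exp, Real.exp_eq_one_iff] at this
      exact this
    congr 1
    apply Complex.ext <;> simp [S, h1]
  -- near any point, `S` is monotone in `θ`
  have hexp : ∀ q : ℝ × ℝ, ∀ b : ℝ × ℝ → ℝ, ContinuousAt b q →
      (∀ᶠ q' in 𝓝 q, Complex.exp (b q' * Complex.I) = E q') →
      ∀ᶠ q' in 𝓝 q, S q' - S q = b q' - b q := by
    intro q b hb hbE
    have h1 : ContinuousAt (fun q' => (S q' - b q') - (S q - b q)) q :=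
      (hS.continuousAt.sub hb).sub continuousAt_const
    have h2 : ∀ᶠ q' in 𝓝 q, |(S q' - b q') - (S q - b q)| < 2 * Real.pi := by
      have := h1.abs
      refine this.eventually (gt_mem_nhds ?_)
      simp [Real.pi_pos]
    filter_upwards [h2, hbE] with q' h3 h4
    have h5 := hbE.self_of_nhds
    rw [← hSE, Complex.exp_eq_exp_iff_exists_int] at h4 h5
    obtain ⟨n, hn⟩ := h4
    obtain ⟨m, hm⟩ := h5
    have hn' : b q' = S q' + n * (2 * Real.pi) := by
      have := congrArg Complex.im hn; simpa using this
    have hm' : b q = S q + m * (2 * Real.pi) := by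
      have := congrArg Complex.im hm; simpa using this
    have h6 : (S q' - b q') - (S q - b q) = ((m - n : ℤ) : ℝ) * (2 * Real.pi) := by
      rw [hn', hm']; push_cast; ring
    rw [h6, abs_mul, abs_of_pos (by positivity : (0:ℝ) < 2 * Real.pi)] at h3
    have h7 : |((m - n : ℤ) : ℝ)| < 1 := by
      have := Real.pi_pos
      nlinarith
    have h8 : m - n = 0 := by
      rw [← Int.abs_lt_one_iff]; exact_mod_cast h7
    have h9 : m = n := by omega
    rw [hn', hm', h9]; ring
  have hmono : ∀ q : ℝ × ℝ, ∀ᶠ q' in 𝓝 q, (θ q ≤ θ q' → S q ≤ S q') ∧ (θ q' ≤ θ q → S q' ≤ S q) := by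
    intro q
    by_cases hq : q ∈ G
    · have hcont : ContinuousAt (fun q => 2 * Real.pi * c (θ q)) q :=
        continuousAt_const.mul (hcc.continuousAt.comp
          (hθ.continuousAt (isOpen_ball.mem_nhds (hGball (subset_closure hq)))))
      have h2 : ∀ᶠ q' in 𝓝 q, Complex.exp (((2 * Real.pi * c (θ q') : ℝ) : ℂ) * Complex.I) = E q' := by
        filter_upwards [hGo.mem_nhds hq] with q' hq'
        exact (if_pos hq').symm
      filter_upwards [hexp q _ hcont h2] with q' h3
      have := Real.pi_pos
      constructor
      · intro h
        have := hcmono h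
        nlinarith
      · intro h
        have := hcmono h
        nlinarith
    · have h2 : ∀ᶠ q' in 𝓝 q, Complex.exp (((0 : ℝ) : ℂ) * Complex.I) = E q' := by
        filter_upwards [hEnot q hq] with q' hq'
        rw [hq']; simp
      filter_upwards [hexp q (fun _ => 0) continuousAt_const h2] with q' h3
      constructor <;> intro <;> linarith
  have hloc : ∀ q, q ∉ G → ∀ m, S q = m → q ∈ interior {q' | S q' = m} := by
    intro q hq m hm
    have h2 : ∀ᶠ q' in 𝓝 q, Complex.exp (((0 : ℝ) : ℂ) * Complex.I) = E q' := by
      filter_upwards [hEnot q hq] with q' hq'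
      rw [hq']; simp
    rw [mem_interior_iff_mem_nhds]
    filter_upwards [hexp q (fun _ => 0) continuousAt_const h2] with q' h3
    show S q' = m
    linarith
  -- constancy of `S` on a large sphere
  obtain ⟨R, hRR, hGR⟩ : ∃ R < R', closure G ⊆ ball 0 R := by
    obtain ⟨x, hx, hxm⟩ := hGc.exists_isMaxOn ⟨q0, subset_closure (hC1G ⟨hq0, rfl⟩)⟩
      continuous_norm.continuousOn
    have hxR := hGball hx
    rw [mem_ball_zero_iff] at hxR
    refine ⟨(‖x‖ + R') / 2, by linarith, fun y hy => ?_⟩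
    have := isMaxOn_iff.1 hxm y hy
    rw [mem_ball_zero_iff]; linarith
  have hq0G : q0 ∈ G := hC1G ⟨hq0, rfl⟩
  have hR0 : 0 < R := pos_of_mem_ball (hGR (subset_closure hq0G))
  obtain ⟨s, hs1, hs⟩ : ∃ s : ℝ, Complex.exp (s * Complex.I) = 1 ∧
      ∀ q ∈ sphere (0 : ℝ × ℝ) R, S q = s := by
    have hconn : IsConnected (sphere (0 : ℝ × ℝ) R) := by
      apply isConnected_sphere _ _ hR0.le
      rw [rank_prod']
      simp [one_add_one_eq_two]
    have hout : ∀ q ∈ sphere (0 : ℝ × ℝ) R, q ∉ G := by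
      intro q hq h
      have := hGR (subset_closure h)
      rw [mem_ball, mem_sphere.1 hq] at this
      exact lt_irrefl _ this
    obtain ⟨a, ha⟩ := hconn.nonempty
    refine ⟨S a, by rw [hSE]; exact if_neg (hout a ha), ?_⟩
    refine hconn.isPreconnected.subset_left_of_subset_union (u := interior {q | S q = S a})
      (v := {q | S q ≠ S a}) isOpen_interior (isOpen_ne_fun hS continuous_const) ?_ ?_
      ⟨a, ha, ?_⟩ |>.trans interior_subset
    · rw [Set.disjoint_left]
      intro q h1 h2
      have h3 : q ∈ {q | S q = S a} := interior_subset h1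
      exact h2 h3
    · intro q hq
      by_cases h : S q = S a
      · exact Or.inl (hloc q (hout q hq) _ h)
      · exact Or.inr h
    · exact hloc a (hout a ha) _ rfl
  have hq0s : S q0 ≠ s := by
    intro h
    have h1 := hSE q0
    have h2 : E q0 = e t := if_pos hq0G
    have h3 : c t = 1 / 2 := by
      simp only [c, sub_self, zero_div, zero_add]
      norm_num
    have h4 : e t = -1 := by
      simp only [e, h3]
      rw [← Complex.exp_pi_mul_I]
      congr 2
      push_cast; ring
    rw [h, hs1, h2, h4] at h1
    norm_num at h1
  -- an extremum of `S` produces one of `θ`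
  have hDball : ∀ q ∈ closedBall (0 : ℝ × ℝ) R, S q ≠ s → q ∈ ball (0 : ℝ × ℝ) R := by
    intro q hq h
    rcases (mem_closedBall.1 hq).lt_or_eq with h1 | h1
    · exact h1
    · exact absurd (hs q h1) h
  have hsub : closedBall (0 : ℝ × ℝ) R ⊆ ball 0 R' := closedBall_subset_ball hRR
  have hcomp : ∀ m, IsCompact (closedBall (0 : ℝ × ℝ) R ∩ {q | S q = m}) := fun m =>
    (isCompact_closedBall _ _).inter_right (isClosed_eq hS continuous_const)
  have hq0R : q0 ∈ closedBall (0 : ℝ × ℝ) R := ball_subset_closedBall (hGR (subset_closure hq0G))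
  rcases lt_or_gt_of_ne hq0s with hlt | hgt
  · obtain ⟨x, hx, hxm⟩ := (isCompact_closedBall (0 : ℝ × ℝ) R).exists_isMinOn ⟨q0, hq0R⟩
      hS.continuousOn
    obtain ⟨y, hy, hym⟩ := (hcomp (S x)).exists_isMinOn ⟨x, hx, rfl⟩
      (hθ.mono (inter_subset_left.trans hsub))
    have hyS : S y = S x := hy.2
    have hyb : y ∈ ball (0 : ℝ × ℝ) R := hDball y hy.1 (by
      have := isMinOn_iff.1 hxm q0 hq0R
      rw [hyS]; linarith [this])
    apply hmin y (hsub hy.1)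
    filter_upwards [hmono y, isOpen_ball.mem_nhds hyb] with q h1 h2
    by_contra hcon
    have h3 := h1.2 (not_le.1 hcon).le
    have h4 := isMinOn_iff.1 hxm q (ball_subset_closedBall h2)
    have h5 := isMinOn_iff.1 hym q ⟨ball_subset_closedBall h2, le_antisymm (h3.trans_eq hyS) h4⟩
    exact hcon h5
  · obtain ⟨x, hx, hxm⟩ := (isCompact_closedBall (0 : ℝ × ℝ) R).exists_isMaxOn ⟨q0, hq0R⟩
      hS.continuousOn
    obtain ⟨y, hy, hym⟩ := (hcomp (S x)).exists_isMaxOn ⟨x, hx, rfl⟩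
      (hθ.mono (inter_subset_left.trans hsub))
    have hyS : S y = S x := hy.2
    have hyb : y ∈ ball (0 : ℝ × ℝ) R := hDball y hy.1 (by
      have := isMaxOn_iff.1 hxm q0 hq0R
      rw [hyS]; linarith [this])
    apply hmax y (hsub hy.1)
    filter_upwards [hmono y, isOpen_ball.mem_nhds hyb] with q h1 h2
    by_contra hcon
    have h3 := h1.1 (not_le.1 hcon).le
    have h4 := isMaxOn_iff.1 hxm q (ball_subset_closedBall h2)
    have h5 := isMaxOn_iff.1 hym q ⟨ball_subset_closedBall h2, le_antisymm h4 (hyS.symm.trans_le h3)⟩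
    exact hcon h5

theorem isPreconnected_diff_of_subset_line {t s r : ℝ} {B : Set (ℝ × ℝ)}
    (hB : B ⊆ {p | p.1 = t}) {p1 : ℝ × ℝ} (hp1 : p1 ∈ ball (t, s) r) (hp1t : p1.1 = t)
    (hp1B : p1 ∉ B) : IsPreconnected (ball (t, s) r \ B) := by
  -- every point of the line is a limit of either side
  set A1 := ball (t, s) r ∩ {p : ℝ × ℝ | p.1 < t}
  set A2 := ball (t, s) r ∩ {p : ℝ × ℝ | t < p.1}
  have hc1 : Convex ℝ A1 := (convex_ball _ _).inter
    ((convex_Iio t).linear_preimage (LinearMap.fst ℝ ℝ ℝ))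
  have hc2 : Convex ℝ A2 := (convex_ball _ _).inter
    ((convex_Ioi t).linear_preimage (LinearMap.fst ℝ ℝ ℝ))
  have key : ∀ (σ : ℝ), ∀ p ∈ ball (t, s) r, p.1 = t →
      Tendsto (fun ε : ℝ => (p.1 + σ * ε, p.2)) (𝓝[>] 0) (𝓝 p) := by
    intro σ p _ _
    have : ContinuousAt (fun ε : ℝ => (p.1 + σ * ε, p.2)) 0 := by fun_prop
    have h2 := this.tendsto
    simp only [mul_zero, add_zero] at h2
    exact h2.mono_left nhdsWithin_le_nhds
  have hcl1 : ∀ p ∈ ball (t, s) r, p.1 = t → p ∈ closure A1 := by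
    intro p hp hpt
    refine mem_closure_of_tendsto (key (-1) p hp hpt) ?_
    filter_upwards [(key (-1) p hp hpt).eventually (isOpen_ball.mem_nhds hp),
      self_mem_nhdsWithin] with ε h1 (h2 : 0 < ε)
    refine ⟨h1, ?_⟩
    show p.1 + -1 * ε < t
    linarith
  have hcl2 : ∀ p ∈ ball (t, s) r, p.1 = t → p ∈ closure A2 := by
    intro p hp hpt
    refine mem_closure_of_tendsto (key 1 p hp hpt) ?_
    filter_upwards [(key 1 p hp hpt).eventually (isOpen_ball.mem_nhds hp),
      self_mem_nhdsWithin] with ε h1 (h2 : 0 < ε)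
    refine ⟨h1, ?_⟩
    show t < p.1 + 1 * ε
    linarith
  have h1 : IsPreconnected (insert p1 A1) := hc1.isPreconnected.subset_closure (subset_insert _ _)
    (insert_subset (hcl1 p1 hp1 hp1t) subset_closure)
  have h2 : IsPreconnected (insert p1 A2) := hc2.isPreconnected.subset_closure (subset_insert _ _)
    (insert_subset (hcl2 p1 hp1 hp1t) subset_closure)
  have h3 := h1.union p1 (mem_insert _ _) (mem_insert _ _) h2
  refine h3.subset_closure ?_ ?_
  · rintro p (hp | hp)
    · rcases hp with rfl | hp
      · exact ⟨hp1, hp1B⟩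
      · exact ⟨hp.1, fun h => (ne_of_lt hp.2) (hB h)⟩
    · rcases hp with rfl | hp
      · exact ⟨hp1, hp1B⟩
      · exact ⟨hp.1, fun h => (ne_of_gt hp.2) (hB h)⟩
  · rintro p ⟨hp, _⟩
    rcases lt_trichotomy p.1 t with h | h | h
    · exact subset_closure (Or.inl (Or.inr ⟨hp, h⟩))
    · exact closure_mono (subset_union_left.trans' (subset_insert _ _)) (hcl1 p hp h)
    · exact subset_closure (Or.inr (Or.inr ⟨hp, h⟩))

/-- If the boundary of an open set lies, inside a box, in the middle line of the box, and does not
fill this line, then the open set is dense in the box. -/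
theorem ball_subset_closure_of_boundary {t s r : ℝ} {O : Set (ℝ × ℝ)} (hO : IsOpen O)
    (hc : (t, s) ∈ closure O) (hB : ∀ p ∈ ball (t, s) r, p ∈ closure O → p ∉ O → p.1 = t)
    {p1 : ℝ × ℝ} (hp1 : p1 ∈ ball (t, s) r) (hp1t : p1.1 = t) (hp1B : p1 ∈ closure O → p1 ∈ O) :
    ball (t, s) r ⊆ closure O := by
  have hr : 0 < r := pos_of_mem_ball hp1
  set B := ball (t, s) r ∩ (closure O \ O)
  have hpre : IsPreconnected (ball (t, s) r \ B) :=
    isPreconnected_diff_of_subset_line (fun p hp => hB p hp.1 hp.2.1 hp.2.2) hp1 hp1t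
      (fun h => h.2.2 (hp1B h.2.1))
  have hsub : ball (t, s) r \ B ⊆ O := by
    refine hpre.subset_left_of_subset_union (v := (closure O)ᶜ) hO isClosed_closure.isOpen_compl
      (disjoint_compl_right.mono_left subset_closure) ?_ ?_
    · rintro p ⟨hp, hpB⟩
      by_cases h : p ∈ O
      · exact Or.inl h
      · exact Or.inr fun h2 => hpB ⟨hp, h2, h⟩
    · obtain ⟨p, hp, hpO⟩ := mem_closure_iff.1 hc _ isOpen_ball (mem_ball_self hr)
      exact ⟨p, ⟨hp, fun h => h.2.2 hpO⟩, hpO⟩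
  intro p hp
  by_cases h : p ∈ B
  · exact h.2.1
  · exact subset_closure (hsub ⟨hp, h⟩)

/-- The fibre of a polynomial over a value. -/
def polyFiber {n : ℕ} (P : MvPolynomial (Fin n) ℂ) (ζ : ℂ) : Set (Fin n → ℂ) :=
  {x | MvPolynomial.eval x P = ζ}

theorem mem_polyFiber {n : ℕ} {P : MvPolynomial (Fin n) ℂ} {ζ : ℂ} {x : Fin n → ℂ} :
    x ∈ polyFiber P ζ ↔ MvPolynomial.eval x P = ζ := Iff.rfl

theorem isClosed_polyFiber {n : ℕ} (P : MvPolynomial (Fin n) ℂ) (ζ : ℂ) :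
    IsClosed (polyFiber P ζ) := isClosed_eq (continuous_evalPoly P) continuous_const

theorem contDiff_evalPoly {n : ℕ} (P : MvPolynomial (Fin n) ℂ) {m : WithTop ℕ∞} :
    ContDiff ℂ m fun x : Fin n → ℂ => MvPolynomial.eval x P := by
  induction P using MvPolynomial.induction_on with
  | C a => simpa using contDiff_const
  | add p q hp hq => simpa using hp.add hq
  | mul_X p i hp => simpa using hp.mul (contDiff_apply ℂ ℂ i)

theorem exists_chart_polyFiber (P : MvPolynomial (Fin 2) ℂ) (ζ : ℂ) (x : polyFiber P ζ)
    (f : (Fin 2 → ℂ) →L[ℂ] ℂ)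
    (hinj : ∀ v, fderiv ℂ (fun z => MvPolynomial.eval z P) x.1 v = 0 → f v = 0 → v = 0) :
    ∃ Ψ : OpenPartialHomeomorph (polyFiber P ζ) ℂ, x ∈ Ψ.source ∧
      (∀ y ∈ Ψ.source, Ψ y = f y.1) ∧
      ∀ᶠ w in 𝓝 (f x.1), DifferentiableAt ℂ (fun w => (Ψ.symm w).1) w := by
  set F : (Fin 2 → ℂ) → ℂ × ℂ := fun z => (MvPolynomial.eval z P, f z) with hF
  have hFc : ContDiff ℂ 1 F := (contDiff_evalPoly P).prodMk f.contDiff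
  set F' : (Fin 2 → ℂ) →L[ℂ] ℂ × ℂ :=
    (fderiv ℂ (fun z => MvPolynomial.eval z P) x.1).prod f with hF'
  have hd : HasFDerivAt F F' x.1 :=
    (((contDiff_evalPoly P (m := 1)).differentiable one_ne_zero).differentiableAt.hasFDerivAt).prodMk
      f.hasFDerivAt
  have hker : Function.Injective F'.toLinearMap := by
    rw [← LinearMap.ker_eq_bot, LinearMap.ker_eq_bot']
    intro v hv
    have hv' : F' v = 0 := hv
    rw [hF', ContinuousLinearMap.prod_apply, Prod.mk_eq_zero] at hv'
    exact hinj v hv'.1 hv'.2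
  let eL : (Fin 2 → ℂ) ≃ₗ[ℂ] ℂ × ℂ := LinearEquiv.ofInjectiveOfFinrankEq F'.toLinearMap hker (by simp)
  let e : (Fin 2 → ℂ) ≃L[ℂ] ℂ × ℂ := eL.toContinuousLinearEquiv
  have he : (e : (Fin 2 → ℂ) →L[ℂ] ℂ × ℂ) = F' := by ext v <;> rfl
  have hd' : HasFDerivAt F (e : (Fin 2 → ℂ) →L[ℂ] ℂ × ℂ) x.1 := he ▸ hd
  let Φ := hFc.contDiffAt.toOpenPartialHomeomorph F hd' one_ne_zero
  have hΦ : ∀ z, Φ z = F z := fun z => rfl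
  have hxΦ : x.1 ∈ Φ.source := hFc.contDiffAt.mem_toOpenPartialHomeomorph_source hd' one_ne_zero
  have hsymm : ContDiffAt ℂ 1 Φ.symm (F x.1) := hFc.contDiffAt.to_localInverse hd' one_ne_zero
  have hFx : F x.1 = (ζ, f x.1) := by
    have := x.2
    rw [mem_polyFiber] at this
    simp [hF, this]
  have hV : ∀ w, (ζ, w) ∈ Φ.target → Φ.symm (ζ, w) ∈ polyFiber P ζ ∧ f (Φ.symm (ζ, w)) = w := by
    intro w hw
    have := Φ.right_inv hw
    rw [hΦ, hF, Prod.mk.injEq] at this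
    exact this
  have hmk : ∀ y : polyFiber P ζ, (ζ, f y.1) = Φ y.1 := by
    intro y
    have := y.2
    rw [mem_polyFiber] at this
    simp [hΦ, hF, this]
  classical
  let inv : ℂ → polyFiber P ζ := fun w =>
    if h : Φ.symm (ζ, w) ∈ polyFiber P ζ then ⟨_, h⟩ else x
  have hinv : ∀ w, (ζ, w) ∈ Φ.target → (inv w).1 = Φ.symm (ζ, w) := by
    intro w hw
    simp only [inv, (hV w hw).1, dif_pos]
  have htopen : IsOpen {w | (ζ, w) ∈ Φ.target} := Φ.open_target.preimage (by fun_prop)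
  let Ψ : OpenPartialHomeomorph (polyFiber P ζ) ℂ :=
    { toFun := fun y => f y.1
      invFun := inv
      source := {y | y.1 ∈ Φ.source}
      target := {w | (ζ, w) ∈ Φ.target}
      map_source' := fun y hy => by
        show (ζ, f y.1) ∈ Φ.target
        rw [hmk]; exact Φ.map_source hy
      map_target' := fun w hw => by
        show (inv w).1 ∈ Φ.source
        rw [hinv w hw]; exact Φ.map_target hw
      left_inv' := fun y hy => by
        have h1 : (ζ, f y.1) ∈ Φ.target := by rw [hmk]; exact Φ.map_source hy
        apply Subtype.ext
        rw [hinv _ h1, hmk]; exact Φ.left_inv hy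
      right_inv' := fun w hw => by
        show f (inv w).1 = w
        rw [hinv w hw]; exact (hV w hw).2
      open_source := Φ.open_source.preimage continuous_subtype_val
      open_target := htopen
      continuousOn_toFun := (f.continuous.comp continuous_subtype_val).continuousOn
      continuousOn_invFun := by
        rw [Topology.IsInducing.subtypeVal.continuousOn_iff]
        have : ContinuousOn (fun w => Φ.symm (ζ, w)) {w | (ζ, w) ∈ Φ.target} :=
          Φ.continuousOn_symm.comp (by fun_prop) fun w hw => hw
        exact this.congr fun w hw => hinv w hw }
  refine ⟨Ψ, hxΦ, fun y _ => rfl, ?_⟩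
  have h1 : ∀ᶠ p in 𝓝 (F x.1), DifferentiableAt ℂ Φ.symm p := by
    filter_upwards [hsymm.eventually (by simp)] with p hp
    exact hp.differentiableAt one_ne_zero
  rw [hFx] at h1
  have hc : ContinuousAt (fun w : ℂ => (ζ, w)) (f x.1) := by fun_prop
  have h3 : f x.1 ∈ {w | (ζ, w) ∈ Φ.target} := by
    show (ζ, f x.1) ∈ Φ.target
    rw [hmk]; exact Φ.map_source hxΦ
  filter_upwards [hc.eventually h1, htopen.mem_nhds h3] with w hw hw2
  have h4 : (fun w => (Ψ.symm w).1) =ᶠ[𝓝 w] fun w => Φ.symm (ζ, w) := by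
    filter_upwards [htopen.mem_nhds hw2] with w' hw'
    exact hinv w' hw'
  refine DifferentiableAt.congr_of_eventuallyEq ?_ h4
  exact hw.comp w (by fun_prop)

theorem exists_transverse_functional {D : (Fin 2 → ℂ) →L[ℂ] ℂ} (hD : D ≠ 0) :
    ∃ f : (Fin 2 → ℂ) →L[ℂ] ℂ, ∀ v, D v = 0 → f v = 0 → v = 0 := by
  have hDv : ∀ v, D v = v 0 * D (Pi.single 0 1) + v 1 * D (Pi.single 1 1) := by
    intro v
    conv_lhs => rw [pi_eq_sum_univ' v]
    simp [Fin.sum_univ_two, map_add]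
  by_cases h : D (Pi.single 0 1) = 0
  · refine ⟨ContinuousLinearMap.proj 0, fun v h1 h2 => ?_⟩
    have h2 : v 0 = 0 := h2
    have h3 : D (Pi.single 1 1) ≠ 0 := by
      intro h3
      apply hD
      ext v
      rw [hDv v, h, h3]; simp
    rw [hDv v, h2, zero_mul, zero_add, mul_eq_zero] at h1
    have h4 := h1.resolve_right h3
    ext i; fin_cases i
    exacts [h2, h4]
  · refine ⟨ContinuousLinearMap.proj 1, fun v h1 h2 => ?_⟩
    have h2 : v 1 = 0 := h2
    rw [hDv v, h2, zero_mul, add_zero, mul_eq_zero] at h1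
    have h4 := h1.resolve_right h
    ext i; fin_cases i
    exacts [h4, h2]

theorem eq_empty_of_isCompact_of_isOpen_polyFiber {P : MvPolynomial (Fin 2) ℂ} {ζ : ℂ}
    (hreg : ∀ x ∈ polyFiber P ζ, fderiv ℂ (fun z => MvPolynomial.eval z P) x ≠ 0)
    {O : Set (polyFiber P ζ)} (hO : IsOpen O) (hOc : IsCompact O) : O = ∅ := by
  by_contra hne
  obtain ⟨x, hx, hxm⟩ := hOc.exists_isMaxOn (nonempty_iff_ne_empty.2 hne)
    (f := fun y => ‖WithLp.toLp 2 y.1‖)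
    ((PiLp.continuous_toLp 2 _).comp continuous_subtype_val).norm.continuousOn
  obtain ⟨f, hf⟩ := exists_transverse_functional (hreg x.1 x.2)
  obtain ⟨Ψ, hxΨ, hΨ, hd⟩ := exists_chart_polyFiber P ζ x f hf
  have hx1 : Ψ.symm (f x.1) = x := by rw [← hΨ x hxΨ]; exact Ψ.left_inv hxΨ
  have hxt : f x.1 ∈ Ψ.target := by rw [← hΨ x hxΨ]; exact Ψ.map_source hxΨ
  let Γ : ℂ → EuclideanSpace ℂ (Fin 2) := fun w => WithLp.toLp 2 (Ψ.symm w).1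
  have hΓd : ∀ᶠ w in 𝓝 (f x.1), DifferentiableAt ℂ Γ w := by
    filter_upwards [hd] with w hw
    exact (PiLp.continuousLinearEquiv 2 ℂ (fun _ : Fin 2 => ℂ)).symm.differentiableAt.comp w hw
  have hc : ContinuousAt Ψ.symm (f x.1) := Ψ.continuousAt_symm hxt
  have hmax : IsLocalMax (norm ∘ Γ) (f x.1) := by
    have h1 : ∀ᶠ w in 𝓝 (f x.1), Ψ.symm w ∈ O := by
      apply hc.eventually
      rw [hx1]
      exact hO.mem_nhds hx
    filter_upwards [h1] with w hw
    have := isMaxOn_iff.1 hxm _ hw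
    simpa [Γ, hx1] using this
  have hconst := Complex.eventually_eq_of_isLocalMax_norm hΓd hmax
  have h2 : ∀ᶠ w in 𝓝 (f x.1), w = f x.1 := by
    filter_upwards [hconst, Ψ.open_target.mem_nhds hxt] with w hw hwt
    have h3 : Ψ.symm w = Ψ.symm (f x.1) := Subtype.ext ((WithLp.toLp_injective 2) hw)
    rw [← Ψ.right_inv hwt, h3, Ψ.right_inv hxt]
  have h3 : ∀ᶠ w in 𝓝[≠] (f x.1), False := by
    filter_upwards [h2.filter_mono nhdsWithin_le_nhds, self_mem_nhdsWithin] with w h4 h5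
    exact h5 h4
  rw [eventually_false_iff_eq_bot] at h3
  exact NeBot.ne inferInstance h3

theorem exists_eval_eq_one_of_notMem {n : ℕ} (x : Fin n → ℂ) (F : Finset (Fin n → ℂ)) (hx : x ∉ F) :
    ∃ e : MvPolynomial (Fin n) ℂ, MvPolynomial.eval x e = 1 ∧
      ∀ y ∈ F, MvPolynomial.eval y e = 0 := by
  classical
  induction F using Finset.induction_on with
  | empty => exact ⟨1, by simp⟩
  | insert y F _ ih =>
    rw [Finset.mem_insert, not_or] at hx
    obtain ⟨e, he1, he0⟩ := ih hx.2
    obtain ⟨i, hi⟩ : ∃ i, x i ≠ y i := by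
      by_contra h
      push Not at h
      exact hx.1 (funext h)
    refine ⟨e * (MvPolynomial.C (x i - y i)⁻¹ * (MvPolynomial.X i - MvPolynomial.C (y i))), ?_, ?_⟩
    · simp [he1, inv_mul_cancel₀ (sub_ne_zero.2 hi)]
    · intro z hz
      rcases Finset.mem_insert.1 hz with rfl | hz
      · simp
      · simp [he0 z hz]

theorem finite_polyFiber_inter_line {n : ℕ} (P : MvPolynomial (Fin n) ℂ) (ζ : ℂ)
    (x u : Fin n → ℂ) (hu : fderiv ℂ (fun z => MvPolynomial.eval z P) x u ≠ 0) :
    (polyFiber P ζ ∩ range fun τ : ℂ => x + τ • u).Finite := by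
  let q : Polynomial ℂ := MvPolynomial.aeval
    (fun i => Polynomial.C (x i) + Polynomial.C (u i) * Polynomial.X) P
  have hq : ∀ τ, q.eval τ = MvPolynomial.eval (x + τ • u) P := by
    intro τ
    simp only [q]
    clear hu q
    induction P using MvPolynomial.induction_on with
    | C a => simp
    | add p q hp hq => rw [map_add, map_add, Polynomial.eval_add, hp, hq]
    | mul_X p i hp =>
      rw [map_mul, map_mul, Polynomial.eval_mul, hp, MvPolynomial.aeval_X, MvPolynomial.eval_X]
      simp only [Polynomial.eval_add, Polynomial.eval_mul, Polynomial.eval_C, Polynomial.eval_X,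
        Pi.add_apply, Pi.smul_apply, smul_eq_mul, mul_comm τ]
  have hq0 : q - Polynomial.C ζ ≠ 0 := by
    intro h0
    have h1 : ∀ τ : ℂ, MvPolynomial.eval (x + τ • u) P = ζ := by
      intro τ
      rw [← hq, sub_eq_zero.1 h0]; simp
    have h2 := (((contDiff_evalPoly P (m := 1)).differentiable
      one_ne_zero).differentiableAt (x := x)).hasFDerivAt.hasLineDerivAt u
    have h3 : HasLineDerivAt ℂ (fun z => MvPolynomial.eval z P) 0 x u := by
      unfold HasLineDerivAt
      simp_rw [h1]
      exact hasDerivAt_const _ _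
    exact hu (HasLineDerivAt.unique h2 h3)
  refine ((q - Polynomial.C ζ).roots.toFinset.finite_toSet.image fun τ => x + τ • u).subset ?_
  rintro _ ⟨hy, τ, rfl⟩
  refine ⟨τ, ?_, rfl⟩
  have hy : MvPolynomial.eval (x + τ • u) P = ζ := hy
  simp [hq0, hq, hy]

theorem polyHull_subset_polyFiber {n : ℕ} {P : MvPolynomial (Fin n) ℂ} {ζ : ℂ} {L : Set (Fin n → ℂ)}
    (hne : L.Nonempty) (hLV : L ⊆ polyFiber P ζ) : polyHull n L ⊆ polyFiber P ζ := by
  intro x hx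
  have h1 : ‖MvPolynomial.eval x (P - MvPolynomial.C ζ)‖ ≤ 0 := by
    refine (hx (P - MvPolynomial.C ζ)).trans (csSup_le (hne.image _) ?_)
    rintro _ ⟨z, hz, rfl⟩
    have := hLV hz
    rw [mem_polyFiber] at this
    simp [this]
  have h2 := norm_le_zero_iff.1 h1
  rw [map_sub, MvPolynomial.eval_C] at h2
  exact sub_eq_zero.1 h2

theorem mem_interior_polyHull_of_projection {P : MvPolynomial (Fin 2) ℂ} {ζ : ℂ}
    {L : Set (Fin 2 → ℂ)} (hLc : IsCompact L) (hne : L.Nonempty) (hLV : L ⊆ polyFiber P ζ)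
    (x : polyFiber P ζ) (hx : x.1 ∈ polyHull 2 L) (β : ℂ)
    (hβ : fderiv ℂ (fun z => MvPolynomial.eval z P) x.1 ![-β, 1] ≠ 0)
    (hβL : ∀ y ∈ L, y 0 + β * y 1 ≠ x.1 0 + β * x.1 1) :
    x ∈ interior (Subtype.val ⁻¹' polyHull 2 L : Set (polyFiber P ζ)) := by
  set f : (Fin 2 → ℂ) →L[ℂ] ℂ := ContinuousLinearMap.proj (R := ℂ) (φ := fun _ : Fin 2 => ℂ) 0 +
    β • ContinuousLinearMap.proj (R := ℂ) (φ := fun _ : Fin 2 => ℂ) 1 with hf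
  set fp : MvPolynomial (Fin 2) ℂ := MvPolynomial.X 0 + MvPolynomial.C β * MvPolynomial.X 1 with hfp
  have hffp : ∀ y, MvPolynomial.eval y fp = f y := by intro y; simp [hf, hfp]
  have hfy : ∀ y, f y = y 0 + β * y 1 := by intro y; simp [hf]
  have hline : ∀ y, f y = f x.1 → ∃ τ : ℂ, x.1 + τ • ![-β, 1] = y := by
    intro y hy
    rw [hfy, hfy] at hy
    refine ⟨y 1 - x.1 1, ?_⟩
    ext i; fin_cases i
    · simp; linear_combination -hy
    · simp
  have hinj : ∀ v, fderiv ℂ (fun z => MvPolynomial.eval z P) x.1 v = 0 → f v = 0 → v = 0 := by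
    intro v h1 h2
    have hv : v = v 1 • ![-β, 1] := by
      rw [hfy] at h2
      ext i; fin_cases i
      · simp; linear_combination h2
      · simp
    rw [hv, map_smul, smul_eq_mul, mul_eq_zero] at h1
    rw [hv, h1.resolve_right hβ, zero_smul]
  obtain ⟨Ψ, hxΨ, hΨ, -⟩ := exists_chart_polyFiber P ζ x f hinj
  obtain ⟨W, hWo, hWΨ⟩ := isOpen_induced_iff.1 Ψ.open_source
  have hxW : x.1 ∈ W := by
    have : x ∈ Subtype.val ⁻¹' W := by rw [hWΨ]; exact hxΨ
    exact this
  -- a polynomial separating `x` from the remaining points on its line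
  have hfin := finite_polyFiber_inter_line P ζ x.1 _ hβ
  classical
  obtain ⟨e, he1, he0⟩ := exists_eval_eq_one_of_notMem x.1 (hfin.toFinset.erase x.1) (by simp)
  have he : ∀ y ∈ polyHull 2 L, f y = f x.1 → y = x.1 ∨ MvPolynomial.eval y e = 0 := by
    intro y hy hyf
    by_cases h : y = x.1
    · exact Or.inl h
    · obtain ⟨τ, hτ⟩ := hline y hyf
      refine Or.inr (he0 y ?_)
      rw [Finset.mem_erase, hfin.mem_toFinset]
      exact ⟨h, polyHull_subset_polyFiber hne hLV hy, τ, hτ⟩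
  have hXc := isCompact_polyHull L
  obtain ⟨r1, hr1, h1⟩ := exists_ball_forall_not hLc f.continuous (c := f x.1) (by
    intro y hy; rw [hfy, hfy]; exact hβL y hy)
  obtain ⟨r2, hr2, h2⟩ := exists_ball_forall_not
    (B := polyHull 2 L ∩ ({y | 1 / 4 ≤ ‖MvPolynomial.eval y e - 1‖} ∩
      {y | 1 / 4 ≤ ‖MvPolynomial.eval y e‖}))
    (hXc.inter_right ((isClosed_le continuous_const
      ((continuous_evalPoly e).sub continuous_const).norm).inter
      (isClosed_le continuous_const (continuous_evalPoly e).norm))) f.continuous (c := f x.1) (by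
    rintro y ⟨hy, hy1, hy2⟩ hyf
    have hy1 : 1 / 4 ≤ ‖MvPolynomial.eval y e - 1‖ := hy1
    have hy2 : 1 / 4 ≤ ‖MvPolynomial.eval y e‖ := hy2
    rcases he y hy hyf with h | h
    · rw [h, he1] at hy1; norm_num at hy1
    · rw [h] at hy2; norm_num at hy2)
  obtain ⟨r3, hr3, h3⟩ := exists_ball_forall_not
    (B := polyHull 2 L ∩ ({y | ‖MvPolynomial.eval y e - 1‖ ≤ 1 / 4} ∩ Wᶜ))
    (hXc.inter_right ((isClosed_le ((continuous_evalPoly e).sub continuous_const).norm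
      continuous_const).inter hWo.isClosed_compl)) f.continuous (c := f x.1) (by
    rintro y ⟨hy, hy1, hy2⟩ hyf
    have hy1 : ‖MvPolynomial.eval y e - 1‖ ≤ 1 / 4 := hy1
    rcases he y hy hyf with h | h
    · rw [h] at hy2; exact hy2 hxW
    · rw [h] at hy1; norm_num at hy1)
  set r := min r1 (min r2 r3)
  have hr0 : 0 < r := by positivity
  have hUf : ∀ y, MvPolynomial.eval y fp ∈ ball (f x.1) r → ‖f y - f x.1‖ < r := by
    intro y hy
    rwa [hffp, mem_ball_iff_norm] at hy
  have hrr1 : r ≤ r1 := min_le_left _ _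
  have hrr2 : r ≤ r2 := (min_le_right _ _).trans (min_le_left _ _)
  have hrr3 : r ≤ r3 := (min_le_right _ _).trans (min_le_right _ _)
  have key : ∀ w ∈ ball (f x.1) r, ∃ y ∈ polyHull 2 L, f y = w ∧ y ∈ W := by
    intro w hw
    obtain ⟨y, hy, hyf, hye⟩ := exists_fiber_of_separated hLc hne fp e
      (isOpen_ball (x := f x.1) (ε := r)) (convex_ball _ _).isPreconnected
      (fun z hz hzU => h1 z ((hUf z hzU).trans_le hrr1) hz)
      (by
        intro y hy hyU
        by_contra hcon
        push Not at hcon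
        exact h2 y ((hUf y hyU).trans_le hrr2) ⟨hy, hcon.1.le, hcon.2.le⟩)
      hx (by rw [hffp]; exact mem_ball_self hr0) (by rw [he1]; norm_num) hw
    rw [hffp] at hyf
    refine ⟨y, hy, hyf, ?_⟩
    by_contra hyW
    refine h3 y ?_ ⟨hy, hye, hyW⟩
    rw [hyf]
    exact (mem_ball_iff_norm.1 hw).trans_le hrr3
  rw [mem_interior_iff_mem_nhds]
  have hcont : ContinuousAt (fun y : polyFiber P ζ => f y.1) x :=
    (f.continuous.comp continuous_subtype_val).continuousAt
  filter_upwards [Ψ.open_source.mem_nhds hxΨ, hcont (ball_mem_nhds _ hr0)] with v hv hvr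
  obtain ⟨y, hy, hyf, hyW⟩ := key (f v.1) hvr
  have hyV := polyHull_subset_polyFiber hne hLV hy
  have hyS : (⟨y, hyV⟩ : polyFiber P ζ) ∈ Ψ.source := by
    rw [← hWΨ]; exact hyW
  have : (⟨y, hyV⟩ : polyFiber P ζ) = v := by
    apply Ψ.injOn hyS hv
    rw [hΨ _ hyS, hΨ _ hv]; exact hyf
  show v.1 ∈ polyHull 2 L
  rw [← this]; exact hy

theorem linearIndependent_of_totallyReal {A : ℝ × ℝ →L[ℝ] (Fin 2 → ℂ)} (hA : Function.Injective A)
    (htr : ∀ v w, A v = Complex.I • A w → A v = 0) :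
    LinearIndependent ℂ ![A (1, 0), A (0, 1)] := by
  have hA0 : ∀ v, A v = 0 → v = 0 := fun v hv => hA (by rw [hv, map_zero])
  have hAe : ∀ a b : ℝ, A (a, b) = (a : ℂ) • A (1, 0) + (b : ℂ) • A (0, 1) := by
    intro a b
    have : ((a, b) : ℝ × ℝ) = a • (1, 0) + b • (0, 1) := by simp
    rw [this, map_add, map_smul, map_smul]
    simp
  rw [LinearIndependent.pair_iff]
  intro s t hst
  have h1 : A (s.re, t.re) = Complex.I • A (-s.im, -t.im) := by
    rw [hAe s.re, hAe (-s.im), ← sub_eq_zero, ← hst]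
    conv_rhs => rw [← Complex.re_add_im s, ← Complex.re_add_im t]
    push_cast
    module
  have h2 := hA0 _ (htr _ _ h1)
  have h3 : A (-s.im, -t.im) = 0 := by
    rw [h2, map_zero, eq_comm, smul_eq_zero] at h1
    exact h1.resolve_left Complex.I_ne_zero
  have h4 := hA0 _ h3
  simp only [Prod.mk_eq_zero, neg_eq_zero] at h2 h4
  exact ⟨Complex.ext h2.1 h4.1, Complex.ext h2.2 h4.2⟩

theorem apply_ne_zero_of_totallyReal {A : ℝ × ℝ →L[ℝ] (Fin 2 → ℂ)} (hA : Function.Injective A)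
    (htr : ∀ v w, A v = Complex.I • A w → A v = 0) {D : (Fin 2 → ℂ) →L[ℂ] ℂ} (hD : D ≠ 0) :
    ∃ v, D (A v) ≠ 0 := by
  by_contra hcon
  push Not at hcon
  apply hD
  have hb := linearIndependent_of_totallyReal hA htr
  apply ContinuousLinearMap.coe_injective
  refine (basisOfLinearIndependentOfCardEqFinrank hb (by simp)).ext fun i => ?_
  rw [coe_basisOfLinearIndependentOfCardEqFinrank]
  fin_cases i <;> simp [hcon]

theorem exists_functional_of_totallyReal {A : ℝ × ℝ →L[ℝ] (Fin 2 → ℂ)} (hA : Function.Injective A)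
    (htr : ∀ v w, A v = Complex.I • A w → A v = 0) {D : (Fin 2 → ℂ) →L[ℂ] ℂ} (hD : D ≠ 0) :
    ∃ f : (Fin 2 → ℂ) →L[ℂ] ℂ, (∀ v, D v = 0 → f v = 0 → v = 0) ∧ ∀ v, f (A v) = 0 → v = 0 := by
  have hb := linearIndependent_of_totallyReal hA htr
  set b := basisOfLinearIndependentOfCardEqFinrank hb (by simp) with hbdef
  have hb0 : b 0 = A (1, 0) := by simp [hbdef]
  have hb1 : b 1 = A (0, 1) := by simp [hbdef]
  have hexp : ∀ v, v = b.coord 0 v • A (1, 0) + b.coord 1 v • A (0, 1) := by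
    intro v
    rw [← hb0, ← hb1]
    conv_lhs => rw [← b.sum_repr v, Fin.sum_univ_two]
    rfl
  have hAe : ∀ v : ℝ × ℝ, A v = (v.1 : ℂ) • b 0 + (v.2 : ℂ) • b 1 := by
    rintro ⟨x, y⟩
    have : ((x, y) : ℝ × ℝ) = x • (1, 0) + y • (0, 1) := by simp
    rw [this, map_add, map_smul, map_smul, hb0, hb1]
    simp
  obtain ⟨σ, hσ, hσD⟩ : ∃ σ : ℂ, (σ = Complex.I ∨ σ = -Complex.I) ∧
      D (A (0, 1)) - σ * D (A (1, 0)) ≠ 0 := by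
    by_contra hcon
    push Not at hcon
    have h1 := hcon _ (Or.inl rfl)
    have h2 := hcon _ (Or.inr rfl)
    have h3 : D (A (0, 1)) = 0 := by linear_combination (h1 + h2) / 2
    have h4 : D (A (1, 0)) = 0 := by
      have : Complex.I * D (A (1, 0)) = 0 := by linear_combination (h2 - h1) / 2
      exact (mul_eq_zero.1 this).resolve_left Complex.I_ne_zero
    obtain ⟨v, hv⟩ := apply_ne_zero_of_totallyReal hA htr hD
    apply hv
    rw [hAe, hb0, hb1, map_add, map_smul, map_smul, h3, h4]; simp
  refine ⟨LinearMap.toContinuousLinearMap (b.coord 0 + σ • b.coord 1), ?_, ?_⟩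
  · intro v hDv hfv
    have hfv' : b.coord 0 v + σ * b.coord 1 v = 0 := by simpa using hfv
    set s := b.coord 0 v with hs
    set t := b.coord 1 v with ht
    have hDv' : s * D (A (1, 0)) + t * D (A (0, 1)) = 0 := by
      rw [hexp v, map_add, map_smul, map_smul] at hDv
      exact hDv
    have ht0 : t = 0 := by
      have : t * (D (A (0, 1)) - σ * D (A (1, 0))) = 0 := by
        linear_combination hDv' - D (A (1, 0)) * hfv'
      exact (mul_eq_zero.1 this).resolve_right hσD
    have hs0 : s = 0 := by linear_combination hfv' - σ * ht0
    rw [hexp v, ← hs, ← ht, hs0, ht0]; simp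
  · intro v hv
    have h0 : b.coord 0 (A v) = v.1 := by
      rw [hAe, map_add, map_smul, map_smul]; simp [-Complex.coe_smul]
    have h1 : b.coord 1 (A v) = v.2 := by
      rw [hAe, map_add, map_smul, map_smul]; simp [-Complex.coe_smul]
    have hv' : (v.1 : ℂ) + σ * v.2 = 0 := by
      have : b.coord 0 (A v) + σ * b.coord 1 (A v) = 0 := by simpa using hv
      rwa [h0, h1] at this
    have hre := congrArg Complex.re hv'
    have him := congrArg Complex.im hv'
    rcases hσ with rfl | rfl
    · simp at hre him; exact Prod.ext hre him
    · simp at hre him; exact Prod.ext hre him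

theorem exists_chart_of_fderiv_ne_zero {θ : ℝ × ℝ → ℝ} {q0 : ℝ × ℝ} (hθ : ContDiffAt ℝ 1 θ q0)
    (hd : fderiv ℝ θ q0 ≠ 0) :
    ∃ χ : OpenPartialHomeomorph (ℝ × ℝ) (ℝ × ℝ), q0 ∈ χ.source ∧ (∀ q, (χ q).1 = θ q) ∧
      ∀ᶠ p in 𝓝 (χ q0), DifferentiableAt ℝ χ.symm p := by
  obtain ⟨l, hl⟩ : ∃ l : ℝ × ℝ →L[ℝ] ℝ, ∀ v, fderiv ℝ θ q0 v = 0 → l v = 0 → v = 0 := by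
    set a := fderiv ℝ θ q0 (1, 0) with ha
    set b := fderiv ℝ θ q0 (0, 1) with hb
    have hexp : ∀ v : ℝ × ℝ, fderiv ℝ θ q0 v = v.1 * a + v.2 * b := by
      rintro ⟨x, y⟩
      have : ((x, y) : ℝ × ℝ) = x • (1, 0) + y • (0, 1) := by simp
      rw [this, map_add, map_smul, map_smul]
      simp [ha, hb]
    by_cases ha0 : a = 0
    · have hb0 : b ≠ 0 := by
        rintro hb0
        exact hd (by ext <;> simp [hexp, ha0, hb0])
      refine ⟨ContinuousLinearMap.fst ℝ ℝ ℝ, fun v h1 h2 => ?_⟩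
      have h2' : v.1 = 0 := h2
      rw [hexp, h2', zero_mul, zero_add] at h1
      exact Prod.ext h2' ((mul_eq_zero.1 h1).resolve_right hb0)
    · refine ⟨ContinuousLinearMap.snd ℝ ℝ ℝ, fun v h1 h2 => ?_⟩
      have h2' : v.2 = 0 := h2
      rw [hexp, h2', zero_mul, add_zero] at h1
      exact Prod.ext ((mul_eq_zero.1 h1).resolve_right ha0) h2'
  set F : ℝ × ℝ → ℝ × ℝ := fun q => (θ q, l q)
  have hFc : ContDiffAt ℝ 1 F q0 := hθ.prodMk l.contDiff.contDiffAt
  set F' : ℝ × ℝ →L[ℝ] ℝ × ℝ := (fderiv ℝ θ q0).prod l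
  have hFd : HasFDerivAt F F' q0 :=
    (hθ.differentiableAt one_ne_zero).hasFDerivAt.prodMk l.hasFDerivAt
  have hinj : Function.Injective F' := by
    rw [injective_iff_map_eq_zero]
    intro v hv
    exact hl v (congrArg Prod.fst hv) (congrArg Prod.snd hv)
  set e : (ℝ × ℝ) ≃L[ℝ] (ℝ × ℝ) :=
    (LinearEquiv.ofInjectiveOfFinrankEq F'.toLinearMap hinj rfl).toContinuousLinearEquiv
  have hFd' : HasFDerivAt F (e : ℝ × ℝ →L[ℝ] ℝ × ℝ) q0 := by
    have : (e : ℝ × ℝ →L[ℝ] ℝ × ℝ) = F' := by ext <;> rfl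
    rwa [this]
  refine ⟨hFc.toOpenPartialHomeomorph F hFd' one_ne_zero,
    hFc.mem_toOpenPartialHomeomorph_source hFd' one_ne_zero, fun q => rfl, ?_⟩
  have := (hFc.to_localInverse hFd' one_ne_zero).eventually (by simp)
  filter_upwards [this] with w hw
  exact hw.differentiableAt one_ne_zero

/-- A `C¹` map between real planes is a local homeomorphism where its derivative is injective. -/
theorem exists_chart_of_injective_fderiv {κ : ℝ × ℝ → ℂ} {q0 : ℝ × ℝ} (hκ : ContDiffAt ℝ 1 κ q0)
    (hd : ∀ v, fderiv ℝ κ q0 v = 0 → v = 0) :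
    ∃ Φ : OpenPartialHomeomorph (ℝ × ℝ) ℂ, q0 ∈ Φ.source ∧ ∀ q, Φ q = κ q := by
  have hinj : Function.Injective (fderiv ℝ κ q0) := by
    rw [injective_iff_map_eq_zero]; exact hd
  set e : (ℝ × ℝ) ≃L[ℝ] ℂ := (LinearEquiv.ofInjectiveOfFinrankEq (fderiv ℝ κ q0).toLinearMap hinj
    (by simp)).toContinuousLinearEquiv
  have hFd' : HasFDerivAt κ (e : ℝ × ℝ →L[ℝ] ℂ) q0 := by
    have : (e : ℝ × ℝ →L[ℝ] ℂ) = fderiv ℝ κ q0 := by ext <;> rfl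
    rw [this]
    exact (hκ.differentiableAt one_ne_zero).hasFDerivAt
  exact ⟨hκ.toOpenPartialHomeomorph κ hFd' one_ne_zero,
    hκ.mem_toOpenPartialHomeomorph_source hFd' one_ne_zero, fun q => rfl⟩

/-- A `C²` function of modulus one and without critical points on the closed unit ball is
`exp (i θ)` there, for a `C¹` function `θ` without critical points on a larger ball. -/
theorem exists_arg_of_norm_eq_one {U : Set (ℝ × ℝ)} (hU : IsOpen U)
    (hQU : closedBall (0 : ℝ × ℝ) 1 ⊆ U) {h : ℝ × ℝ → ℂ} (hh : ContDiffOn ℝ 2 h U)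
    (h1 : ∀ q ∈ closedBall (0 : ℝ × ℝ) 1, ‖h q‖ = 1)
    (hd : ∀ q ∈ closedBall (0 : ℝ × ℝ) 1, ∃ v, fderiv ℝ h q v ≠ 0) :
    ∃ R' : ℝ, 1 < R' ∧ ∃ θ : ℝ × ℝ → ℝ,
      (∀ q ∈ ball (0 : ℝ × ℝ) R', ContDiffAt ℝ 1 θ q ∧ fderiv ℝ θ q ≠ 0) ∧
      ∀ q ∈ closedBall (0 : ℝ × ℝ) 1, h q = Complex.exp (θ q * Complex.I) := by
  have hdiff : ∀ q ∈ U, HasFDerivAt h (fderiv ℝ h q) q := fun q hq =>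
    ((hh.contDiffAt (hU.mem_nhds hq)).differentiableAt (by norm_num)).hasFDerivAt
  have hdc : ContinuousOn (fderiv ℝ h) U := hh.continuousOn_fderiv_of_isOpen hU (by norm_num)
  have hhc : ContinuousOn h U := hh.continuousOn
  set ω : ℝ × ℝ → ℝ × ℝ →L[ℝ] ℝ := fun q => Complex.imCLM.comp ((h q)⁻¹ • fderiv ℝ h q)
  set g : ℝ × ℝ → ℝ × ℝ →L[ℝ] ℝ := fun q =>
    Complex.reCLM.comp ((starRingEnd ℂ (h q)) • fderiv ℝ h q)
  have hgc : ContinuousOn g U := continuousOn_const.clm_comp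
    ((Complex.continuous_conj.comp_continuousOn hhc).smul hdc)
  have hg0 : EqOn g 0 (ball 0 1) := by
    intro q hq
    have hqU := hQU (ball_subset_closedBall hq)
    have e1 : (fun q => ‖h q‖ ^ 2) =ᶠ[𝓝 q] fun _ => (1 : ℝ) := by
      filter_upwards [isOpen_ball.mem_nhds hq] with q' hq'
      rw [h1 _ (ball_subset_closedBall hq')]; norm_num
    have e2 := (hdiff q hqU).norm_sq.unique ((hasFDerivAt_const (1 : ℝ) q).congr_of_eventuallyEq e1)
    refine ContinuousLinearMap.ext fun v => ?_
    have e3 : (2 : ℕ) • inner ℝ (h q) (fderiv ℝ h q v) = 0 := congrArg (fun T => T v) e2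
    have e4 : inner ℝ (h q) (fderiv ℝ h q v) = 0 := (smul_eq_zero.1 e3).resolve_left two_ne_zero
    rw [Complex.inner] at e4
    show (starRingEnd ℂ (h q) * fderiv ℝ h q v).re = 0
    rw [mul_comm]; exact e4
  have hg1 : EqOn g 0 (closedBall 0 1) := by
    refine hg0.of_subset_closure (hgc.mono hQU) continuousOn_const ball_subset_closedBall ?_
    rw [closure_ball _ one_ne_zero]
  have hS0 : ∀ q ∈ closedBall (0 : ℝ × ℝ) 1, h q ≠ 0 := fun q hq h0 => by
    have := h1 q hq; rw [h0, norm_zero] at this; norm_num at this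
  have hω0 : ∀ q ∈ closedBall (0 : ℝ × ℝ) 1, ω q ≠ 0 := by
    intro q hq h0
    obtain ⟨v, hv⟩ := hd q hq
    have e1 : ((h q)⁻¹ * fderiv ℝ h q v).im = 0 := congrArg (fun T => T v) h0
    have e2 : (starRingEnd ℂ (h q) * fderiv ℝ h q v).re = 0 := congrArg (fun T => T v) (hg1 hq)
    have e3 : starRingEnd ℂ (h q) = (h q)⁻¹ := by
      rw [Complex.inv_def, Complex.normSq_eq_norm_sq, h1 q hq]; simp
    rw [e3] at e2
    have : (h q)⁻¹ * fderiv ℝ h q v = 0 := Complex.ext e2 e1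
    rcases mul_eq_zero.1 this with h | h
    · exact hS0 q hq (inv_eq_zero.1 h)
    · exact hv h
  set S := {q ∈ U | h q ≠ 0}
  have hSo : IsOpen S := hhc.isOpen_inter_preimage hU isOpen_ne
  have hωc : ContinuousOn ω S := continuousOn_const.clm_comp
    (((hhc.mono (fun q hq => hq.1)).inv₀ fun q hq => hq.2).smul (hdc.mono fun q hq => hq.1))
  set S2 := S ∩ ω ⁻¹' {0}ᶜ
  have hS2o : IsOpen S2 := hωc.isOpen_inter_preimage hSo isOpen_compl_singleton
  obtain ⟨δ, hδ, hδS⟩ := (isCompact_closedBall (0 : ℝ × ℝ) 1).exists_thickening_subset_open hS2o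
    fun q hq => ⟨⟨hQU hq, hS0 q hq⟩, hω0 q hq⟩
  rw [thickening_closedBall hδ zero_le_one] at hδS
  have hR1 : 1 < δ + 1 := by linarith
  obtain ⟨H, hHc, hH⟩ := (convex_ball (0 : ℝ × ℝ) (δ + 1)).exists_continuousOn_log isOpen_ball
    (E := h) (hhc.mono fun q hq => (hδS hq).1.1) fun q hq => (hδS hq).1.2
  refine ⟨δ + 1, hR1, fun q => (H q).im, ?_, ?_⟩
  · intro q hq
    have hqS := hδS hq
    have hHq : ContinuousAt H q := hHc.continuousAt (isOpen_ball.mem_nhds hq)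
    have hhq : ContDiffAt ℝ 2 h q := hh.contDiffAt (hU.mem_nhds hqS.1.1)
    have hev : H =ᶠ[𝓝 q] fun q' => Complex.log (h q' / h q) + H q := by
      have : ∀ᶠ q' in 𝓝 q, ‖H q' - H q‖ < 1 := by
        have h2 : Tendsto (fun q' => ‖H q' - H q‖) (𝓝 q) (𝓝 ‖H q - H q‖) :=
          (hHq.sub continuousAt_const).norm
        rw [sub_self, norm_zero] at h2
        exact h2.eventually (gt_mem_nhds one_pos)
      filter_upwards [this, isOpen_ball.mem_nhds hq] with q' hq' hqb
      rw [← hH q' hqb, ← hH q hq, ← Complex.exp_sub, Complex.log_exp]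
      · ring
      · have := (abs_le.1 (Complex.abs_im_le_norm (H q' - H q))).1
        linarith [Real.pi_gt_three]
      · have := (abs_le.1 (Complex.abs_im_le_norm (H q' - H q))).2
        linarith [Real.pi_gt_three]
    have hHd : ContDiffAt ℝ 2 H q := by
      refine ContDiffAt.congr_of_eventuallyEq ?_ hev
      refine ContDiffAt.add ?_ contDiffAt_const
      have hl : ContDiffAt ℝ 2 Complex.log (h q / h q) :=
        (Complex.contDiffAt_log (n := 2) (by rw [div_self hqS.1.2]; simp)).restrict_scalars ℝ
      exact hl.comp q (hhq.div_const _)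
    have hHf := (hHd.differentiableAt (by norm_num)).hasFDerivAt
    have hcomp : ContDiffAt ℝ 1 (fun q => (H q).im) q :=
      (Complex.imCLM.contDiff.contDiffAt.comp q hHd).of_le (by norm_num)
    refine ⟨hcomp, ?_⟩
    have e1 : HasFDerivAt (fun q => (H q).im) (Complex.imCLM.comp (fderiv ℝ H q)) q :=
      Complex.imCLM.hasFDerivAt.comp q hHf
    have e2 : HasFDerivAt h (Complex.exp (H q) • fderiv ℝ H q) q := by
      refine hHf.cexp.congr_of_eventuallyEq ?_
      filter_upwards [isOpen_ball.mem_nhds hq] with q' hq' using (hH q' hq').symm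
    rw [e1.fderiv]
    have e3 : fderiv ℝ H q = (h q)⁻¹ • fderiv ℝ h q := by
      rw [e2.fderiv, hH q hq, smul_smul, inv_mul_cancel₀ hqS.1.2, one_smul]
    rw [e3]
    exact hqS.2
  · intro q hq
    have hqb : q ∈ ball (0 : ℝ × ℝ) (δ + 1) := closedBall_subset_ball hR1 hq
    have hre : (H q).re = 0 := by
      have := h1 q hq
      rw [← hH q hqb, Complex.norm_exp] at this
      simpa using this
    rw [← hH q hqb]
    congr 1
    conv_lhs => rw [← Complex.re_add_im (H q), hre]
    simp

end

section

open Metric Set Filter Topology MeasureTheory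

theorem eq_of_exp_mul_I_eq {a b : ℝ}
    (h : Complex.exp (a * Complex.I) = Complex.exp (b * Complex.I)) (hab : |a - b| < 2 * Real.pi) :
    a = b := by
  obtain ⟨n, hn⟩ := Complex.exp_eq_exp_iff_exists_int.1 h
  have h1 : a = b + n * (2 * Real.pi) := by
    have := congrArg Complex.im hn
    simpa using this
  rw [h1, add_sub_cancel_left, abs_mul, abs_of_pos Real.two_pi_pos] at hab
  have h2 : |(n : ℝ)| < 1 := by
    by_contra hcon
    push Not at hcon
    nlinarith [Real.two_pi_pos]
  have h3 : n = 0 := Int.abs_lt_one_iff.1 (by exact_mod_cast h2)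
  rw [h1, h3]; simp

theorem exists_nhds_volume_level_eq_zero {θ : ℝ × ℝ → ℝ} {q0 : ℝ × ℝ} (hθ : ContDiffAt ℝ 1 θ q0)
    (hd : fderiv ℝ θ q0 ≠ 0) : ∃ u ∈ 𝓝 q0, volume (u ∩ {q | θ q = θ q0}) = 0 := by
  obtain ⟨χ, hq0, hχ, hχd⟩ := exists_chart_of_fderiv_ne_zero hθ hd
  obtain ⟨W, hW, hWo, hWm⟩ := _root_.eventually_nhds_iff.1 hχd
  refine ⟨χ.source ∩ χ ⁻¹' W, Filter.inter_mem (χ.open_source.mem_nhds hq0)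
    (χ.continuousAt hq0 (hWo.mem_nhds hWm)), ?_⟩
  have hnull : volume ({p : ℝ × ℝ | p.1 = θ q0} ∩ W) = 0 := by
    refine measure_mono_null inter_subset_left ?_
    have : {p : ℝ × ℝ | p.1 = θ q0} = {θ q0} ×ˢ univ := by ext p; simp
    rw [this, Measure.volume_eq_prod, Measure.prod_prod]
    simp
  refine measure_mono_null (t := χ.symm '' ({p : ℝ × ℝ | p.1 = θ q0} ∩ W)) ?_ ?_
  · rintro q ⟨⟨hq, hqW⟩, hqθ⟩
    refine ⟨χ q, ⟨?_, hqW⟩, χ.left_inv hq⟩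
    show (χ q).1 = θ q0
    rw [hχ]; exact hqθ
  · exact addHaar_image_eq_zero_of_differentiableOn_of_addHaar_eq_zero volume
      (fun p hp => (hW p hp.2).differentiableWithinAt) hnull

theorem volume_eq_zero_of_exp_eq {R' : ℝ} {θ : ℝ × ℝ → ℝ}
    (hθ : ∀ q ∈ ball (0 : ℝ × ℝ) R', ContDiffAt ℝ 1 θ q ∧ fderiv ℝ θ q ≠ 0) {M : Set (ℝ × ℝ)}
    (hM : M ⊆ ball 0 R') {ζ : ℂ} (hζ : ∀ q ∈ M, Complex.exp (θ q * Complex.I) = ζ) :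
    volume M = 0 := by
  refine measure_null_of_locally_null M fun q0 hq0 => ?_
  obtain ⟨h1, h2⟩ := hθ q0 (hM hq0)
  obtain ⟨u, hu, hu0⟩ := exists_nhds_volume_level_eq_zero h1 h2
  have hnear : ∀ᶠ q in 𝓝 q0, |θ q - θ q0| < 2 * Real.pi := by
    have h3 : Tendsto (fun q => |θ q - θ q0|) (𝓝 q0) (𝓝 |θ q0 - θ q0|) :=
      (h1.continuousAt.sub continuousAt_const).abs
    rw [sub_self, abs_zero] at h3
    exact h3.eventually (gt_mem_nhds (by positivity))
  refine ⟨(u ∩ {q | |θ q - θ q0| < 2 * Real.pi}) ∩ M,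
    inter_mem (mem_nhdsWithin_of_mem_nhds (inter_mem hu hnear)) self_mem_nhdsWithin, ?_⟩
  refine measure_mono_null ?_ hu0
  rintro q ⟨⟨hqu, hq⟩, hqM⟩
  refine ⟨hqu, eq_of_exp_mul_I_eq ?_ hq⟩
  rw [hζ q hqM, hζ q0 hq0]

theorem volume_image_eq_zero {M : Set (ℝ × ℝ)} (hM : volume M = 0) {g : ℝ × ℝ → ℂ}
    (hg : DifferentiableOn ℝ g M) : volume (g '' M) = 0 := by
  have h1 : volume ((fun q => Complex.equivRealProdCLM (g q)) '' M) = 0 :=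
    addHaar_image_eq_zero_of_differentiableOn_of_addHaar_eq_zero volume
      (fun q hq => (Complex.equivRealProdCLM.differentiableAt).comp_differentiableWithinAt q
        (hg q hq)) hM
  have h2 := Complex.volume_preserving_equiv_real_prod.measure_preimage_equiv
    ((fun q => Complex.equivRealProdCLM (g q)) '' M)
  rw [h1] at h2
  refine measure_mono_null ?_ h2
  rintro _ ⟨q, hq, rfl⟩
  exact ⟨q, hq, rfl⟩

theorem exists_projection_avoiding {M : Set (ℝ × ℝ)} (hM : volume M = 0)
    {φ : ℝ × ℝ → Fin 2 → ℂ} (hφ : DifferentiableOn ℝ φ M) {x : Fin 2 → ℂ} (hx : x ∉ φ '' M)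
    {T : (Fin 2 → ℂ) →L[ℂ] ℂ} (hT : T ≠ 0) :
    ∃ β : ℂ, T ![-β, 1] ≠ 0 ∧ ∀ y ∈ φ '' M, y 0 + β * y 1 ≠ x 0 + β * x 1 := by
  set M' := {q ∈ M | φ q 1 - x 1 ≠ 0}
  set g : ℝ × ℝ → ℂ := fun q => -((φ q 0 - x 0) / (φ q 1 - x 1)) with hg
  have hφi : ∀ i, DifferentiableOn ℝ (fun q => φ q i) M' := fun i =>
    differentiableOn_pi.1 (hφ.mono fun q hq => hq.1) i
  have hgd : DifferentiableOn ℝ g M' := by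
    refine DifferentiableOn.neg ?_
    have h1 : DifferentiableOn ℝ (fun q => (φ q 1 - x 1)⁻¹) M' :=
      ((hφi 1).sub_const _).inv fun q hq => hq.2
    simp only [div_eq_mul_inv]
    exact ((hφi 0).sub_const (x 0)).mul h1
  have h0 := volume_image_eq_zero (measure_mono_null (fun q hq => hq.1) hM) hgd
  set e0 : Fin 2 → ℂ := ![1, 0] with he0
  set e1 : Fin 2 → ℂ := ![0, 1] with he1
  have hTe : ∀ β : ℂ, T ![-β, 1] = -β * T e0 + T e1 := by
    intro β
    have : (![-β, 1] : Fin 2 → ℂ) = (-β) • e0 + e1 := by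
      ext i; fin_cases i <;> simp [he0, he1]
    rw [this, map_add, map_smul, smul_eq_mul]
  have hTne : ¬ (T e0 = 0 ∧ T e1 = 0) := by
    rintro ⟨ha, hb⟩
    apply hT
    refine ContinuousLinearMap.ext fun v => ?_
    have : v = v 0 • e0 + v 1 • e1 := by ext i; fin_cases i <;> simp [he0, he1]
    rw [this, map_add, map_smul, map_smul, ha, hb]; simp
  obtain ⟨β, hβ⟩ : ∃ β, β ∉ g '' M' ∪ {T e1 / T e0} := by
    by_contra hcon
    push Not at hcon
    have h1 : volume (g '' M' ∪ {T e1 / T e0}) = 0 := measure_union_null h0 (measure_singleton _)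
    rw [eq_univ_of_forall hcon] at h1
    exact (Measure.measure_univ_ne_zero.2 (NeZero.ne volume)) h1
  refine ⟨β, ?_, ?_⟩
  · intro hb
    rw [hTe] at hb
    by_cases ha : T e0 = 0
    · exact hTne ⟨ha, by simpa [ha] using hb⟩
    · exact hβ (Or.inr (by rw [mem_singleton_iff]; field_simp; linear_combination -hb))
  · rintro _ ⟨q, hq, rfl⟩ heq
    by_cases h1 : φ q 1 - x 1 = 0
    · apply hx
      refine ⟨q, hq, ?_⟩
      have h1' : φ q 1 = x 1 := sub_eq_zero.1 h1
      rw [h1', add_left_inj] at heq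
      ext i; fin_cases i
      · exact heq
      · exact h1'
    · refine hβ (Or.inl ⟨q, ⟨hq, h1⟩, ?_⟩)
      simp only [hg]
      field_simp
      linear_combination -heq

end

section

open Metric Set Filter Topology

/-- A totally real disc, parametrised by `φ`, on which the polynomial `P` equals `exp (i θ)` for a
function `θ` without critical points. -/
structure IsArgDisc (P : MvPolynomial (Fin 2) ℂ) (φ : ℝ × ℝ → Fin 2 → ℂ) (θ : ℝ × ℝ → ℝ)
    (R' : ℝ) : Prop where
  one_lt : 1 < R'
  contDiffAt : ∀ q ∈ closedBall (0 : ℝ × ℝ) 1, ContDiffAt ℝ 2 φ q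
  injOn : InjOn φ (closedBall 0 1)
  injective_fderiv : ∀ q ∈ closedBall (0 : ℝ × ℝ) 1, Function.Injective (fderiv ℝ φ q)
  totallyReal : ∀ q ∈ closedBall (0 : ℝ × ℝ) 1, ∀ v w,
    fderiv ℝ φ q v = Complex.I • fderiv ℝ φ q w → fderiv ℝ φ q v = 0
  regular : ∀ x, ‖MvPolynomial.eval x P‖ = 1 → fderiv ℂ (fun z => MvPolynomial.eval z P) x ≠ 0
  arg_contDiffAt : ∀ q ∈ ball (0 : ℝ × ℝ) R', ContDiffAt ℝ 1 θ q
  arg_fderiv : ∀ q ∈ ball (0 : ℝ × ℝ) R', fderiv ℝ θ q ≠ 0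
  eval_eq : ∀ q ∈ closedBall (0 : ℝ × ℝ) 1,
    MvPolynomial.eval (φ q) P = Complex.exp (θ q * Complex.I)

namespace IsArgDisc

variable {P : MvPolynomial (Fin 2) ℂ} {φ : ℝ × ℝ → Fin 2 → ℂ} {θ : ℝ × ℝ → ℝ} {R' : ℝ}

theorem subset_ball (h : IsArgDisc P φ θ R') : closedBall (0 : ℝ × ℝ) 1 ⊆ ball 0 R' :=
  closedBall_subset_ball h.one_lt

theorem continuousOn (h : IsArgDisc P φ θ R') : ContinuousOn φ (closedBall 0 1) := fun q hq =>
  (h.contDiffAt q hq).continuousAt.continuousWithinAt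

theorem continuousOn_arg (h : IsArgDisc P φ θ R') : ContinuousOn θ (ball 0 R') := fun q hq =>
  (h.arg_contDiffAt q hq).continuousAt.continuousWithinAt

theorem norm_eval (h : IsArgDisc P φ θ R') {q : ℝ × ℝ} (hq : q ∈ closedBall (0 : ℝ × ℝ) 1) :
    ‖MvPolynomial.eval (φ q) P‖ = 1 := by
  rw [h.eval_eq q hq, Complex.norm_exp_ofReal_mul_I]

theorem volume_level (h : IsArgDisc P φ θ R') {M : Set (ℝ × ℝ)} (hM : M ⊆ closedBall 0 1) {ζ : ℂ}
    (hζ : ∀ q ∈ M, MvPolynomial.eval (φ q) P = ζ) : MeasureTheory.volume M = 0 :=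
  volume_eq_zero_of_exp_eq (fun q hq => ⟨h.arg_contDiffAt q hq, h.arg_fderiv q hq⟩)
    (hM.trans h.subset_ball) fun q hq => (h.eval_eq q (hM hq)).symm.trans (hζ q hq)

theorem exists_box (h : IsArgDisc P φ θ R') {ζ : ℂ} {q0 : ℝ × ℝ}
    (hq0 : q0 ∈ closedBall (0 : ℝ × ℝ) 1) (hx0 : φ q0 ∈ polyFiber P ζ) :
    ∃ (F : OpenPartialHomeomorph (ℝ × ℝ) (polyFiber P ζ))
      (χ : OpenPartialHomeomorph (ℝ × ℝ) (ℝ × ℝ)), q0 ∈ χ.source ∧ (∀ q, (χ q).1 = θ q) ∧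
      ∀ᶠ q in 𝓝 q0, ∀ hq : φ q ∈ polyFiber P ζ, χ q ∈ F.source ∧ F (χ q) = ⟨φ q, hq⟩ := by
  have hreg := h.regular (φ q0) (h.norm_eval hq0)
  obtain ⟨f, hf1, hf2⟩ := exists_functional_of_totallyReal (h.injective_fderiv q0 hq0)
    (h.totallyReal q0 hq0) hreg
  obtain ⟨χ, hχ0, hχ, -⟩ := exists_chart_of_fderiv_ne_zero
    (h.arg_contDiffAt q0 (h.subset_ball hq0)) (h.arg_fderiv q0 (h.subset_ball hq0))
  obtain ⟨Ψ, hΨ0, hΨ, -⟩ := exists_chart_polyFiber P ζ ⟨φ q0, hx0⟩ f hf1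
  have hφd : ContDiffAt ℝ 1 φ q0 := (h.contDiffAt q0 hq0).of_le (by norm_num)
  have hκ : ContDiffAt ℝ 1 (fun q => f (φ q)) q0 :=
    (f.restrictScalars ℝ).contDiff.contDiffAt.comp q0 hφd
  have hκd : fderiv ℝ (fun q => f (φ q)) q0 = (f.restrictScalars ℝ).comp (fderiv ℝ φ q0) :=
    ((f.restrictScalars ℝ).hasFDerivAt.comp q0
      (hφd.differentiableAt one_ne_zero).hasFDerivAt).fderiv
  obtain ⟨Φ, hΦ0, hΦ⟩ := exists_chart_of_injective_fderiv hκ (by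
    intro v hv
    rw [hκd] at hv
    exact hf2 v hv)
  obtain ⟨W, hWo, hW⟩ := isOpen_induced_iff.1 Ψ.open_source
  have hWm : φ q0 ∈ W := by
    have : (⟨φ q0, hx0⟩ : polyFiber P ζ) ∈ Subtype.val ⁻¹' W := by rw [hW]; exact hΨ0
    exact this
  refine ⟨χ.symm.trans (Φ.trans Ψ.symm), χ, hχ0, hχ, ?_⟩
  filter_upwards [χ.open_source.mem_nhds hχ0, Φ.open_source.mem_nhds hΦ0,
    hφd.continuousAt (hWo.mem_nhds hWm)] with q hqχ hqΦ hqW hq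
  have hqΨ : (⟨φ q, hq⟩ : polyFiber P ζ) ∈ Ψ.source := by rw [← hW]; exact hqW
  have hΦΨ : Φ q = Ψ ⟨φ q, hq⟩ := by rw [hΦ, hΨ _ hqΨ]
  constructor
  · rw [OpenPartialHomeomorph.trans_source, OpenPartialHomeomorph.trans_source]
    refine ⟨χ.map_source hqχ, ?_, ?_⟩
    · rw [χ.left_inv hqχ]; exact hqΦ
    · show Φ (χ.symm (χ q)) ∈ Ψ.target
      rw [χ.left_inv hqχ, hΦΨ]
      exact Ψ.map_source hqΨ
  · show Ψ.symm (Φ (χ.symm (χ q))) = _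
    rw [χ.left_inv hqχ, hΦΨ, Ψ.left_inv hqΨ]

theorem eventually_mem_boundary (h : IsArgDisc P φ θ R') {ζ : ℂ} {M : Set (ℝ × ℝ)}
    (hM : IsCompact M) (hMQ : M ⊆ closedBall 0 1) (hMζ : ∀ q ∈ M, φ q ∈ polyFiber P ζ)
    {O : Set (polyFiber P ζ)} (hO : IsOpen O) (hOreg : interior (closure O) ⊆ O)
    (hB : closure O \ O ⊆ Subtype.val ⁻¹' (φ '' M)) {q0 : ℝ × ℝ} (hq0 : q0 ∈ M)
    (hq0B : (⟨φ q0, hMζ q0 hq0⟩ : polyFiber P ζ) ∈ closure O \ O) :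
    ∀ᶠ q in 𝓝 q0, θ q = θ q0 → q ∈ M ∩ φ ⁻¹' (Subtype.val '' (closure O \ O)) := by
  obtain ⟨F, χ, hχ0, hχ, hF⟩ := h.exists_box (hMQ hq0) (hMζ q0 hq0)
  set x0 : polyFiber P ζ := ⟨φ q0, hMζ q0 hq0⟩
  have hnear : ∀ᶠ q in 𝓝 q0, |θ q - θ q0| < 2 * Real.pi := by
    have h3 : Tendsto (fun q => |θ q - θ q0|) (𝓝 q0) (𝓝 |θ q0 - θ q0|) :=
      ((h.arg_contDiffAt q0 (h.subset_ball (hMQ hq0))).continuousAt.sub continuousAt_const).abs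
    rw [sub_self, abs_zero] at h3
    exact h3.eventually (gt_mem_nhds (by positivity))
  obtain ⟨N, hN, hNo, hN0⟩ := _root_.eventually_nhds_iff.1
    ((hF.and hnear).and (χ.open_source.mem_nhds hχ0))
  obtain ⟨hF0s, hF0⟩ := (hN q0 hN0).1.1 (hMζ q0 hq0)
  -- points of the image of `M` near `x0` come from parameters near `q0`
  have hW : ∀ᶠ x in 𝓝 x0, ∀ q ∈ M, φ q = x.1 → q ∈ N := by
    have hc : IsCompact (φ '' (M \ N)) :=
      (hM.diff hNo).image_of_continuousOn (h.continuousOn.mono fun q hq => hMQ hq.1)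
    have hx : x0.1 ∈ (φ '' (M \ N))ᶜ := by
      rintro ⟨q, hq, hqx⟩
      have := h.injOn (hMQ hq.1) (hMQ hq0) hqx
      exact hq.2 (this ▸ hN0)
    filter_upwards [continuous_subtype_val.continuousAt (hc.isClosed.isOpen_compl.mem_nhds hx)]
      with x hx q hq hqx
    by_contra hqN
    exact hx ⟨q, ⟨hq, hqN⟩, hqx⟩
  have hW' : ∀ᶠ p in 𝓝 (χ q0), p ∈ F.source ∧ ∀ q ∈ M, φ q = (F p).1 → q ∈ N := by
    refine Filter.Eventually.and (F.open_source.mem_nhds hF0s) ?_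
    have : ContinuousAt F (χ q0) := F.continuousAt hF0s
    rw [ContinuousAt, hF0] at this
    exact this.eventually hW
  obtain ⟨r, hr, hball⟩ := Metric.eventually_nhds_iff_ball.1 hW'
  -- boundary points in the box
  have hbox : ∀ p ∈ ball (χ q0) r, F p ∈ closure O → F p ∉ O →
      ∃ q ∈ M, q ∈ N ∧ χ q = p ∧ φ q = (F p).1 ∧ θ q = θ q0 := by
    intro p hp hp1 hp2
    obtain ⟨q, hq, hqp⟩ := hB ⟨hp1, hp2⟩
    have hqN := (hball p hp).2 q hq hqp
    obtain ⟨hqs, hqF⟩ := (hN q hqN).1.1 (hMζ q hq)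
    refine ⟨q, hq, hqN, F.injOn hqs (hball p hp).1 ?_, hqp, ?_⟩
    · rw [hqF]; exact Subtype.ext hqp
    · refine eq_of_exp_mul_I_eq ?_ (hN q hqN).1.2
      rw [← h.eval_eq q (hMQ hq), ← h.eval_eq q0 (hMQ hq0), mem_polyFiber.1 (hMζ q hq),
        mem_polyFiber.1 (hMζ q0 hq0)]
  set O' := F.source ∩ F ⁻¹' O
  have hO'o : IsOpen O' := F.isOpen_inter_preimage hO
  have hcl : ∀ p ∈ F.source, (p ∈ closure O' ↔ F p ∈ closure O) := by
    intro p hp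
    have h1 := F.preimage_closure O
    constructor
    · intro hpc
      have : p ∈ F.source ∩ closure (F ⁻¹' O) := ⟨hp, closure_mono inter_subset_right hpc⟩
      rw [← h1] at this
      exact this.2
    · intro hpc
      have : p ∈ F.source ∩ F ⁻¹' closure O := ⟨hp, hpc⟩
      rw [h1] at this
      exact F.open_source.inter_closure this
  have hχev : ∀ᶠ q in 𝓝 q0, χ q ∈ ball (χ q0) r :=
    (χ.continuousAt hχ0) (ball_mem_nhds _ hr)
  filter_upwards [hχev, hNo.mem_nhds hN0] with q hqr hqN hqθ
  by_contra hqC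
  have hp1 : F (χ q) ∈ closure O → F (χ q) ∈ O := by
    intro h1
    by_contra h2
    obtain ⟨q', hq', hq'N, hq'χ, hq'φ, -⟩ := hbox _ hqr h1 h2
    have : q' = q := χ.injOn (hN q' hq'N).2 (hN q hqN).2 hq'χ
    subst this
    exact hqC ⟨hq', F (χ q'), ⟨h1, h2⟩, hq'φ.symm⟩
  have hsub : ball (χ q0) r ⊆ closure O' := by
    refine ball_subset_closure_of_boundary (t := (χ q0).1) (s := (χ q0).2) hO'o
      ((hcl _ hF0s).2 (by rw [hF0]; exact hq0B.1)) ?_ (p1 := χ q) hqr ?_ ?_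
    · intro p hp hpc hpO
      obtain ⟨q', -, -, hq'χ, -, hq'θ⟩ := hbox p hp ((hcl p (hball p hp).1).1 hpc)
        fun hpO' => hpO ⟨(hball p hp).1, hpO'⟩
      rw [← hq'χ, hχ, hχ, hq'θ]
    · rw [hχ, hχ, hqθ]
    · intro h1
      exact ⟨(hball _ hqr).1, hp1 ((hcl _ (hball _ hqr).1).1 h1)⟩
  apply hq0B.2
  apply hOreg
  have hx0F : x0 = F (χ q0) := hF0.symm
  rw [mem_interior_iff_mem_nhds, hx0F, ← F.map_nhds_eq hF0s]
  rw [Filter.mem_map]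
  filter_upwards [ball_mem_nhds (χ q0) hr] with p hp
  exact (hcl p (hball p hp).1).1 (hsub hp)

theorem polyHull_level_subset (h : IsArgDisc P φ θ R') {ζ : ℂ} {M : Set (ℝ × ℝ)}
    (hM : IsCompact M) (hMQ : M ⊆ closedBall 0 1) (hMne : M.Nonempty)
    (hMζ : ∀ q ∈ M, φ q ∈ polyFiber P ζ) : polyHull 2 (φ '' M) ⊆ φ '' M := by
  have hLc : IsCompact (φ '' M) := hM.image_of_continuousOn (h.continuousOn.mono hMQ)
  have hne : (φ '' M).Nonempty := hMne.image φ
  have hLV : φ '' M ⊆ polyFiber P ζ := by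
    rintro _ ⟨q, hq, rfl⟩; exact hMζ q hq
  have hζ : ‖ζ‖ = 1 := by
    obtain ⟨q, hq⟩ := hMne
    rw [← mem_polyFiber.1 (hMζ q hq)]; exact h.norm_eval (hMQ hq)
  have hreg : ∀ x ∈ polyFiber P ζ, fderiv ℂ (fun z => MvPolynomial.eval z P) x ≠ 0 := by
    intro x hx
    refine h.regular x ?_
    rw [mem_polyFiber.1 hx, hζ]
  set X : Set (polyFiber P ζ) := Subtype.val ⁻¹' polyHull 2 (φ '' M)
  have hXcl : IsClosed X := (isCompact_polyHull _).isClosed.preimage continuous_subtype_val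
  have hXc : IsCompact X :=
    (isClosed_polyFiber P ζ).isClosedEmbedding_subtypeVal.isCompact_preimage
      (isCompact_polyHull _)
  set O := interior X
  have hOX : closure O ⊆ X := hXcl.closure_interior_subset
  have hXO : ∀ x ∈ X, x.1 ∉ φ '' M → x ∈ O := by
    intro x hx hxL
    obtain ⟨β, hβ1, hβ2⟩ := exists_projection_avoiding (h.volume_level hMQ hMζ)
      (fun q hq => ((h.contDiffAt q (hMQ hq)).differentiableAt
        (by norm_num)).differentiableWithinAt) hxL (hreg x.1 x.2)
    exact mem_interior_polyHull_of_projection hLc hne hLV x hx β hβ1 hβ2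
  have hB : closure O \ O ⊆ Subtype.val ⁻¹' (φ '' M) := by
    intro x hx
    by_contra hxL
    exact hx.2 (hXO x (hOX hx.1) hxL)
  set C := M ∩ φ ⁻¹' (Subtype.val '' (closure O \ O))
  have hBc : IsClosed (Subtype.val '' (closure O \ O)) :=
    (isClosed_polyFiber P ζ).isClosedEmbedding_subtypeVal.isClosedMap _
      (isClosed_closure.sdiff isOpen_interior)
  have hCc : IsCompact C :=
    hM.of_isClosed_subset ((h.continuousOn.mono hMQ).preimage_isClosed_of_isClosed hM.isClosed hBc)
      inter_subset_left
  have hC0 : C = ∅ := by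
    refine eq_empty_of_isolated_level h.continuousOn_arg
      (fun q hq hm => h.arg_fderiv q hq hm.fderiv_eq_zero)
      (fun q hq hm => h.arg_fderiv q hq hm.fderiv_eq_zero) hCc
      ((inter_subset_left.trans hMQ).trans h.subset_ball) ?_
    rintro q0 ⟨hq0, x, hx, hxq⟩
    have hx' : (⟨φ q0, hMζ q0 hq0⟩ : polyFiber P ζ) ∈ closure O \ O := by
      have : (⟨φ q0, hMζ q0 hq0⟩ : polyFiber P ζ) = x := Subtype.ext hxq.symm
      rw [this]; exact hx
    exact h.eventually_mem_boundary hM hMQ hMζ isOpen_interior (interior_mono hOX) hB hq0 hx'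
  have hOcl : closure O ⊆ O := by
    intro x hx
    by_contra hxO
    obtain ⟨q, hq, hqx⟩ := hB ⟨hx, hxO⟩
    have : q ∈ C := ⟨hq, x, ⟨hx, hxO⟩, hqx.symm⟩
    rw [hC0] at this
    exact this
  have hO0 : O = ∅ := eq_empty_of_isCompact_of_isOpen_polyFiber hreg isOpen_interior
    (hXc.of_isClosed_subset (closure_subset_iff_isClosed.1 hOcl) interior_subset)
  intro x hx
  by_contra hxL
  have : (⟨x, polyHull_subset_polyFiber hne hLV hx⟩ : polyFiber P ζ) ∈ O := hXO _ hx hxL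
  rw [hO0] at this
  exact this

end IsArgDisc

theorem mem_polyHull_inter_level {n : ℕ} {K : Set (Fin n → ℂ)} (hK : IsCompact K)
    {P : MvPolynomial (Fin n) ℂ} (hP : ∀ z ∈ K, ‖MvPolynomial.eval z P‖ ≤ 1) {x : Fin n → ℂ}
    (hne : K.Nonempty) (hx : x ∈ polyHull n K) (hPx : ‖MvPolynomial.eval x P‖ = 1) :
    (K ∩ {z | MvPolynomial.eval z P = MvPolynomial.eval x P}).Nonempty ∧
      x ∈ polyHull n (K ∩ {z | MvPolynomial.eval z P = MvPolynomial.eval x P}) := by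
  set ζ := MvPolynomial.eval x P with hζ
  set L := K ∩ {z | MvPolynomial.eval z P = ζ}
  have key : ∀ (g : MvPolynomial (Fin n) ℂ) (c : ℝ), 0 < c →
      (∀ z ∈ L, ‖MvPolynomial.eval z g‖ < c) → ‖MvPolynomial.eval x g‖ ≤ c := by
    intro g c hc hgc
    by_contra! hcon
    set u : MvPolynomial (Fin n) ℂ :=
      MvPolynomial.C (1 / 2) * (1 + MvPolynomial.C (starRingEnd ℂ ζ) * P) with hu
    have hue : ∀ z, MvPolynomial.eval z u =
        (1 / 2 : ℝ) • (1 : ℂ) + (1 / 2 : ℝ) • (starRingEnd ℂ ζ * MvPolynomial.eval z P) := by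
      intro z
      simp [hu]; ring
    have hζζ : starRingEnd ℂ ζ * ζ = 1 := by
      rw [mul_comm, Complex.mul_conj, Complex.normSq_eq_norm_sq, hPx]; simp
    have hux : MvPolynomial.eval x u = 1 := by
      rw [hue, ← hζ, hζζ, ← add_smul]; norm_num
    have hwn : ∀ z ∈ K, ‖starRingEnd ℂ ζ * MvPolynomial.eval z P‖ ≤ 1 := by
      intro z hz
      rw [norm_mul, RCLike.norm_conj, hPx, one_mul]; exact hP z hz
    have hu1 : ∀ z ∈ K, ‖MvPolynomial.eval z u‖ ≤ 1 := by
      intro z hz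
      rw [hue]
      refine (norm_add_le _ _).trans ?_
      rw [norm_smul, norm_smul, norm_one, Real.norm_of_nonneg (by norm_num)]
      linarith [hwn z hz]
    have hu2 : ∀ z ∈ K, z ∉ L → ‖MvPolynomial.eval z u‖ < 1 := by
      intro z hz hzL
      rw [hue]
      refine norm_combo_lt_of_ne norm_one.le (hwn z hz) ?_ (by norm_num) (by norm_num)
        (by norm_num)
      intro h
      refine hzL ⟨hz, ?_⟩
      show MvPolynomial.eval z P = ζ
      linear_combination (-ζ) * h - MvPolynomial.eval z P * hζζ
    set E := K ∩ {z | c ≤ ‖MvPolynomial.eval z g‖}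
    have hEc : IsCompact E :=
      hK.inter_right (isClosed_le continuous_const (continuous_evalPoly g).norm)
    obtain ⟨s, hs0, hs1, hs⟩ : ∃ s : ℝ, 0 ≤ s ∧ s < 1 ∧ ∀ z ∈ E, ‖MvPolynomial.eval z u‖ ≤ s := by
      rcases E.eq_empty_or_nonempty with h | h
      · exact ⟨0, le_rfl, one_pos, by simp [h]⟩
      · obtain ⟨z0, hz0, hmax⟩ := hEc.exists_isMaxOn h (continuous_evalPoly u).norm.continuousOn
        refine ⟨_, norm_nonneg _, hu2 z0 hz0.1 fun h => ?_, fun z hz => hmax hz⟩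
        exact absurd (hgc z0 h) (not_lt.2 hz0.2)
    obtain ⟨G, hG⟩ := (hK.image (continuous_evalPoly g)).isBounded.exists_norm_le
    have hG' : ∀ z ∈ K, ‖MvPolynomial.eval z g‖ ≤ G := fun z hz => hG _ ⟨z, hz, rfl⟩
    obtain ⟨N, hN⟩ : ∃ N : ℕ, s ^ N * G < c := by
      have := (tendsto_pow_atTop_nhds_zero_of_lt_one hs0 hs1).mul_const G
      rw [zero_mul] at this
      exact (this.eventually (gt_mem_nhds hc)).exists
    have h1 := hx (u ^ N * g)
    rw [map_mul, map_pow, hux, one_pow, one_mul] at h1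
    refine absurd (h1.trans (csSup_le (hne.image _) ?_)) (not_le.2 hcon)
    rintro _ ⟨z, hz, rfl⟩
    simp only [map_mul, map_pow, norm_mul, norm_pow]
    by_cases hzE : c ≤ ‖MvPolynomial.eval z g‖
    · refine le_trans ?_ hN.le
      exact mul_le_mul (pow_le_pow_left₀ (norm_nonneg _) (hs z ⟨hz, hzE⟩) N) (hG' z hz)
        (norm_nonneg _) (pow_nonneg hs0 N)
    · push Not at hzE
      exact (mul_le_of_le_one_left (norm_nonneg _)
        (pow_le_one₀ (norm_nonneg _) (hu1 z hz))).trans hzE.le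
  have hLc : IsCompact L := hK.inter_right (isClosed_eq (continuous_evalPoly P) continuous_const)
  have hLne : L.Nonempty := by
    by_contra hemp
    rw [not_nonempty_iff_eq_empty] at hemp
    have := key 1 (1 / 2) (by norm_num) (by simp [hemp])
    norm_num at this
  refine ⟨hLne, fun g => ?_⟩
  have hbdd : BddAbove ((fun w => ‖MvPolynomial.eval w g‖) '' L) :=
    (hLc.image (continuous_evalPoly g).norm).bddAbove
  have h0 : 0 ≤ sSup ((fun w => ‖MvPolynomial.eval w g‖) '' L) := by
    obtain ⟨z, hz⟩ := hLne
    exact (norm_nonneg _).trans (le_csSup hbdd ⟨z, hz, rfl⟩)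
  refine le_of_forall_pos_le_add fun ε hε => key g _ (by linarith) fun z hz => ?_
  have := le_csSup hbdd ⟨z, hz, rfl⟩
  simp only at this
  linarith

theorem IsCompact.exists_continuousOn_comp_eq {X Y Z : Type*} [TopologicalSpace X]
    [TopologicalSpace Y] [T2Space Y] [TopologicalSpace Z] [Nonempty X] {Q : Set X}
    (hQ : IsCompact Q) {φ : X → Y} (hφ : ContinuousOn φ Q) (hinj : InjOn φ Q) {θ : X → Z}
    (hθ : ContinuousOn θ Q) : ∃ θ' : Y → Z, ContinuousOn θ' (φ '' Q) ∧ ∀ q ∈ Q, θ' (φ q) = θ q := by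
  have hinv : ∀ q ∈ Q, Function.invFunOn φ Q (φ q) = q := fun q hq => hinj.leftInvOn_invFunOn hq
  refine ⟨fun y => θ (Function.invFunOn φ Q y), ?_, fun q hq => congrArg θ (hinv q hq)⟩
  rw [continuousOn_iff_isClosed]
  intro A hA
  obtain ⟨u, hu, hAu⟩ := continuousOn_iff_isClosed.1 hθ A hA
  refine ⟨φ '' (u ∩ Q),
    ((hQ.inter_left hu).image_of_continuousOn (hφ.mono inter_subset_right)).isClosed, ?_⟩
  ext y
  constructor
  · rintro ⟨hy, q, hq, rfl⟩
    have hy' : θ (Function.invFunOn φ Q (φ q)) ∈ A := hy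
    rw [hinv q hq] at hy'
    exact ⟨⟨q, hAu ▸ ⟨hy', hq⟩, rfl⟩, q, hq, rfl⟩
  · rintro ⟨⟨q, hq, rfl⟩, hy⟩
    refine ⟨?_, hy⟩
    show θ (Function.invFunOn φ Q (φ q)) ∈ A
    rw [hinv q hq.2]
    rw [← hAu] at hq
    exact hq.1

namespace IsArgDisc

variable {P : MvPolynomial (Fin 2) ℂ} {φ : ℝ × ℝ → Fin 2 → ℂ} {θ : ℝ × ℝ → ℝ} {R' : ℝ}

theorem image_inter_level (ζ : ℂ) :
    φ '' closedBall 0 1 ∩ {z | MvPolynomial.eval z P = ζ} =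
      φ '' (closedBall 0 1 ∩ φ ⁻¹' polyFiber P ζ) :=
  (image_inter_preimage _ _ _).symm

theorem isCompact_level (h : IsArgDisc P φ θ R') (ζ : ℂ) :
    IsCompact (closedBall (0 : ℝ × ℝ) 1 ∩ φ ⁻¹' polyFiber P ζ) :=
  (isCompact_closedBall _ _).of_isClosed_subset
    (h.continuousOn.preimage_isClosed_of_isClosed isClosed_closedBall (isClosed_polyFiber P ζ))
    inter_subset_left

theorem polyHull_subset (h : IsArgDisc P φ θ R') :
    polyHull 2 (φ '' closedBall 0 1) ⊆ φ '' closedBall 0 1 := by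
  have hQ : IsCompact (closedBall (0 : ℝ × ℝ) 1) := isCompact_closedBall _ _
  have hK := hQ.image_of_continuousOn h.continuousOn
  have hne : (φ '' closedBall 0 1).Nonempty := ⟨_, 0, mem_closedBall_self zero_le_one, rfl⟩
  obtain ⟨θ', hθ', hθ'e⟩ := hQ.exists_continuousOn_comp_eq h.continuousOn h.injOn
    (h.continuousOn_arg.mono h.subset_ball)
  have hPe : ∀ z ∈ φ '' closedBall 0 1,
      MvPolynomial.eval z P = Complex.exp (θ' z * Complex.I) := by
    rintro _ ⟨q, hq, rfl⟩
    rw [hθ'e q hq, h.eval_eq q hq]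
  refine polyHull_subset_of_arg hK hne P θ' hθ' hPe ?_ ?_
  · intro x hx hPx
    obtain ⟨h1, h2⟩ := mem_polyHull_inter_level hK
      (fun z hz => by rw [hPe z hz, Complex.norm_exp_ofReal_mul_I]) hne hx hPx
    rw [image_inter_level] at h1 h2
    have h3 := h.polyHull_level_subset (h.isCompact_level _) inter_subset_left h1.of_image
      (fun q hq => hq.2) h2
    exact image_mono inter_subset_left h3
  · rintro x₀ ⟨q0, hq0, rfl⟩
    set ζ := MvPolynomial.eval (φ q0) P
    set M := closedBall (0 : ℝ × ℝ) 1 ∩ φ ⁻¹' polyFiber P ζ with hM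
    have hMne : M.Nonempty := ⟨q0, hq0, rfl⟩
    have hMc := h.isCompact_level ζ
    have hMQ : M ⊆ closedBall 0 1 := inter_subset_left
    have hχ : ContinuousOn (fun z => ((max 0 (1 - |θ' z - θ' (φ q0)|) : ℝ) : ℂ)) (φ '' M) :=
      (show Continuous fun s : ℝ => ((max 0 (1 - |s - θ' (φ q0)|) : ℝ) : ℂ) by
        fun_prop).comp_continuousOn (hθ'.mono (image_mono hMQ))
    obtain ⟨e, he⟩ := exists_eval_near_indicator
      (hMc.image_of_continuousOn (h.continuousOn.mono hMQ)) (hMne.image φ)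
      (h.polyHull_level_subset hMc hMQ hMne fun q hq => hq.2)
      (fun i => by
        rw [image_image]
        exact volume_image_eq_zero (h.volume_level hMQ fun q hq => hq.2) fun q hq =>
          (differentiableAt_pi.1 ((h.contDiffAt q (hMQ hq)).differentiableAt
            (by norm_num)) i).differentiableWithinAt)
      hχ (ε := 1 / 4) (by norm_num)
    refine ⟨e, fun y hy hyP => ?_⟩
    have hyM : y ∈ φ '' M := by
      rw [hM, ← image_inter_level]
      exact ⟨hy, hyP⟩
    have hey := he y hyM
    by_cases hlt : |θ' y - θ' (φ q0)| < 2 * Real.pi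
    · have heq : θ' y = θ' (φ q0) := by
        refine eq_of_exp_mul_I_eq ?_ hlt
        rw [← hPe y hy, hyP, ← hPe (φ q0) ⟨q0, hq0, rfl⟩]
      refine Or.inl ⟨heq, ?_⟩
      simpa [heq] using hey
    · push Not at hlt
      have hne' : θ' y ≠ θ' (φ q0) := by
        intro heq
        rw [heq, sub_self, abs_zero] at hlt
        linarith [Real.pi_pos]
      refine Or.inr ⟨hne', ?_⟩
      have h0 : max 0 (1 - |θ' y - θ' (φ q0)|) = 0 :=
        max_eq_left (by linarith [Real.pi_gt_three])
      simpa [h0] using hey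

end IsArgDisc

theorem TotallyRealDisc.polyConvex {P : MvPolynomial (Fin 2) ℂ} {K : Set (Fin 2 → ℂ)}
    (hK : TotallyRealDisc 2 K) (hKP : ∀ z ∈ K, ‖MvPolynomial.eval z P‖ = 1)
    (hreg : ∀ z, ‖MvPolynomial.eval z P‖ = 1 →
      fderiv ℂ (fun w => MvPolynomial.eval w P) z ≠ 0) : PolyConvex 2 K := by
  obtain ⟨U, φ, hU, hQU, hφ, hinj, hdinj, htr, rfl⟩ := hK
  have hφa : ∀ q ∈ U, ContDiffAt ℝ 2 φ q := fun q hq => hφ.contDiffAt (hU.mem_nhds hq)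
  have hPd : ContDiff ℝ 2 fun z : Fin 2 → ℂ => MvPolynomial.eval z P :=
    (contDiff_evalPoly P).restrict_scalars ℝ
  obtain ⟨R', hR', θ, hθ, hexp⟩ := exists_arg_of_norm_eq_one hU hQU
    (h := fun q => MvPolynomial.eval (φ q) P) (hPd.comp_contDiffOn hφ)
    (fun q hq => hKP _ ⟨q, hq, rfl⟩) (by
      intro q hq
      obtain ⟨v, hv⟩ := apply_ne_zero_of_totallyReal (hdinj q (hQU hq)) (htr q (hQU hq))
        (hreg (φ q) (hKP _ ⟨q, hq, rfl⟩))
      refine ⟨v, ?_⟩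
      have h1 : HasFDerivAt (fun z : Fin 2 → ℂ => MvPolynomial.eval z P)
          (fderiv ℂ (fun z => MvPolynomial.eval z P) (φ q)) (φ q) :=
        ((contDiff_evalPoly P (m := 1)).differentiable one_ne_zero _).hasFDerivAt
      have h2 := (h1.restrictScalars ℝ).comp q
        ((hφa q (hQU hq)).differentiableAt (by norm_num)).hasFDerivAt
      have h3 : fderiv ℝ (fun q => MvPolynomial.eval (φ q) P) q = _ := h2.fderiv
      rw [h3]
      exact hv)
  have h : IsArgDisc P φ θ R' :=
    { one_lt := hR'
      contDiffAt := fun q hq => hφa q (hQU hq)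
      injOn := hinj.mono hQU
      injective_fderiv := fun q hq => hdinj q (hQU hq)
      totallyReal := fun q hq => htr q (hQU hq)
      regular := hreg
      arg_contDiffAt := fun q hq => (hθ q hq).1
      arg_fderiv := fun q hq => (hθ q hq).2
      eval_eq := hexp }
  exact h.polyHull_subset.antisymm
    (subset_polyHull ((isCompact_closedBall _ _).image_of_continuousOn h.continuousOn))

end

/-- Every totally real `C²`-smooth disc lying in the non-singular
part of the boundary of a complex non-degenerate polynomial polyhedron
`𝔇 = {z ∈ ℂ² : |p j z| < 1 ∀ j}` (i.e. contained in a single face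
`Σ j = {|p j| = 1}` and avoiding all other faces) is polynomially convex. -/
theorem totallyRealDisc_in_boundary_polyhedron_polyConvex
    (l : ℕ) (p : Fin l → MvPolynomial (Fin 2) ℂ)
    (D : Set (Fin 2 → ℂ))
    (hD : D = {z | ∀ j : Fin l, ‖MvPolynomial.eval z (p j)‖ < 1})
    (Sig : Fin l → Set (Fin 2 → ℂ))
    (hSig : ∀ j, Sig j = {z | ‖MvPolynomial.eval z (p j)‖ = 1})
    -- complex non-degeneracy (collections of size 1 and 2, since n = 2):
    (hnd1 : ∀ j : Fin l, ∀ z ∈ Sig j,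
      fderiv ℂ (fun w => MvPolynomial.eval w (p j)) z ≠ 0)
    (hnd2 : ∀ j₁ j₂ : Fin l, j₁ < j₂ → ∀ z ∈ Sig j₁ ∩ Sig j₂,
      LinearIndependent ℂ
        ![fderiv ℂ (fun w => MvPolynomial.eval w (p j₁)) z,
          fderiv ℂ (fun w => MvPolynomial.eval w (p j₂)) z])
    (K : Set (Fin 2 → ℂ)) (hK : TotallyRealDisc 2 K)
    (hKbd : K ⊆ frontier D)
    (j : Fin l) (hKface : K ⊆ Sig j)
    (hKreg : ∀ j' : Fin l, j' ≠ j → K ∩ Sig j' = ∅) :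
    PolyConvex 2 K := by
  exact hK.polyConvex (fun z hz => by
      have h := hKface hz
      rw [hSig] at h
      exact h) fun z hz => hnd1 j z (by rw [hSig]; exact hz)
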